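/- Let q be an odd prime power and let H₁ be the orbit of the point (ξ^{(q+1)/2}, 0, 0, 1) under the group K ≅ PSL(2,q²) (induced on PG(3,q²) by the matrices A^q ⊗ A with A ∈ SL(2,𝔽_{q²})). For every k ∈ {1,…,q−2}\{(q−1)/2}, the set H₁ ∪ E_k is a quasi-Hermitian surface of PG(3,q²): it has exactly (q²+1)(q³+1) points, and every plane of PG(3,q²) meets it in either q³+1 or q³+q²+1 points. -/

import Mathlib

noncomputable section

open Matrix

/-- The points of `PG(3,q²)`: the projectivization of `F⁴` where `F = 𝔽_{q²}`. -/
abbrev PGPoint (F : Type*) [Field F] := Projectivization F (Fin 4 → F)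

/-- The form `F_γ(X₁,X₂,X₃,X₄) = X₁^q X₄ + X₁ X₄^q − X₂^{q+1} − X₃^{q+1}
    − γ (X₁X₄ − X₂X₃)^{(q+1)/2}`. -/
def Fgam {F : Type*} [Field F] (q : ℕ) (γ : F) (x : Fin 4 → F) : F :=
  x 0 ^ q * x 3 + x 0 * x 3 ^ q - x 1 ^ (q + 1) - x 2 ^ (q + 1)
    - γ * (x 0 * x 3 - x 1 * x 2) ^ ((q + 1) / 2)

/-- The point set `C_γ` of `PG(3,q²)`, the zero locus of `F_γ`. -/
def Cgam {F : Type*} [Field F] (q : ℕ) (γ : F) : Set (PGPoint F) :=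
  {P | ∀ (v : Fin 4 → F) (hv : v ≠ 0), P = Projectivization.mk F v hv → Fgam q γ v = 0}

/-- Kronecker product of two 2×2 matrices, as a 4×4 matrix. -/
def kron {F : Type*} [Field F] (A B : Matrix (Fin 2) (Fin 2) F) :
    Matrix (Fin 4) (Fin 4) F :=
  Matrix.of fun i j =>
    A ⟨i.val / 2, by have := i.isLt; omega⟩ ⟨j.val / 2, by have := j.isLt; omega⟩ *
    B ⟨i.val % 2, by have := i.isLt; omega⟩ ⟨j.val % 2, by have := j.isLt; omega⟩

/-- Entrywise `q`-th power (the matrix `A^q`). -/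
def matq {F : Type*} [Field F] (q : ℕ) (A : Matrix (Fin 2) (Fin 2) F) :
    Matrix (Fin 2) (Fin 2) F :=
  A.map (· ^ q)

/-- The orbit of a point of `PG(3,q²)` under the group `K ≅ PSL(2,q²)` of projectivities
    induced by the matrices `A^q ⊗ A` with `A ∈ SL(2,𝔽_{q²})`. -/
def Korb {F : Type*} [Field F] (q : ℕ) (P : PGPoint F) : Set (PGPoint F) :=
  {P' | ∃ A : Matrix (Fin 2) (Fin 2) F, A.det = 1 ∧
    ∃ (v : Fin 4 → F) (hv : v ≠ 0) (hw : Matrix.vecMul v (kron (matq q A) A) ≠ 0),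
      P = Projectivization.mk F v hv ∧ P' = Projectivization.mk F _ hw}

/-- The orbit of a point of `PG(3,q²)` under the group `G ≅ PGL(2,q²)` of projectivities
    induced by the matrices `A^q ⊗ A` with `A ∈ GL(2,𝔽_{q²})`. -/
def Gorb {F : Type*} [Field F] (q : ℕ) (P : PGPoint F) : Set (PGPoint F) :=
  {P' | ∃ A : Matrix (Fin 2) (Fin 2) F, A.det ≠ 0 ∧
    ∃ (v : Fin 4 → F) (hv : v ≠ 0) (hw : Matrix.vecMul v (kron (matq q A) A) ≠ 0),
      P = Projectivization.mk F v hv ∧ P' = Projectivization.mk F _ hw}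

/-- The Hermitian Veronese curve `O = {(1,t,t^q,t^{q+1})} ∪ {(0,0,0,1)}`. -/
def Oset (F : Type*) [Field F] (q : ℕ) : Set (PGPoint F) :=
  {P | (∃ (t : F) (hv : ![1, t, t ^ q, t ^ (q + 1)] ≠ 0),
        P = Projectivization.mk F _ hv) ∨
    ∃ (hv : (![0, 0, 0, 1] : Fin 4 → F) ≠ 0), P = Projectivization.mk F _ hv}

/-- The Baer subgeometry `Σ = {(a,b,b^q,c) : a,c ∈ 𝔽_q, b ∈ 𝔽_{q²}}`. -/
def SigmaSet (F : Type*) [Field F] (q : ℕ) : Set (PGPoint F) :=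
  {P | ∃ (a b c : F) (hv : ![a, b, b ^ q, c] ≠ 0),
    a ^ q = a ∧ c ^ q = c ∧ P = Projectivization.mk F _ hv}

/-- The hyperbolic quadric `Q⁺(3,q²) : X₁X₄ − X₂X₃ = 0`. -/
def Qplus (F : Type*) [Field F] : Set (PGPoint F) :=
  {P | ∀ (v : Fin 4 → F) (hv : v ≠ 0), P = Projectivization.mk F v hv →
    v 0 * v 3 - v 1 * v 2 = 0}

/-- A line of `PG(3,q²)`: the set of points lying in a 2-dimensional subspace. -/
def IsLine {F : Type*} [Field F] (ℓ : Set (PGPoint F)) : Prop :=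
  ∃ W : Submodule F (Fin 4 → F), Module.finrank F W = 2 ∧ ℓ = {P | P.rep ∈ W}

/-- A plane of `PG(3,q²)`: the set of points lying in a 3-dimensional subspace. -/
def IsPlane {F : Type*} [Field F] (π : Set (PGPoint F)) : Prop :=
  ∃ W : Submodule F (Fin 4 → F), Module.finrank F W = 3 ∧ π = {P | P.rep ∈ W}

section QuasiHermitian

open scoped Classical
open Finset

variable {F : Type*} [Field F] {σ : F →+* F}

/-- The rank one tensor `x^q ⊗ y`. -/
def herProd (σ : F →+* F) (x y : F × F) : Fin 4 → F :=
  ![σ x.1 * y.1, σ x.1 * y.2, σ x.2 * y.1, σ x.2 * y.2]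

/-- The sesquilinear form on `F²` induced by a linear form on the tensor square. -/
def sesq (σ : F →+* F) (l : Fin 4 → F) (x y : F × F) : F :=
  l ⬝ᵥ herProd σ x y

/-- The determinant of the matrix with rows `x` and `y`. -/
def det₂ (x y : F × F) : F := x.1 * y.2 - x.2 * y.1

theorem sesq_eq (σ : F →+* F) (l : Fin 4 → F) (x y : F × F) : sesq σ l x y =
    l 0 * (σ x.1 * y.1) + l 1 * (σ x.1 * y.2) + l 2 * (σ x.2 * y.1) + l 3 * (σ x.2 * y.2) := by
  simp [sesq, herProd, dotProduct, Fin.sum_univ_four]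

theorem sesq_add_right (l : Fin 4 → F) (x y z : F × F) :
    sesq σ l x (y + z) = sesq σ l x y + sesq σ l x z := by
  simp only [sesq_eq, Prod.fst_add, Prod.snd_add]; ring

theorem sesq_add_left (l : Fin 4 → F) (x y z : F × F) :
    sesq σ l (x + y) z = sesq σ l x z + sesq σ l y z := by
  simp only [sesq_eq, Prod.fst_add, Prod.snd_add, map_add]; ring

theorem sesq_smul_right (l : Fin 4 → F) (t : F) (x y : F × F) :
    sesq σ l x (t • y) = t * sesq σ l x y := by
  simp only [sesq_eq, Prod.smul_fst, Prod.smul_snd, smul_eq_mul]; ring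

theorem sesq_smul_left (l : Fin 4 → F) (t : F) (x y : F × F) :
    sesq σ l (t • x) y = σ t * sesq σ l x y := by
  simp only [sesq_eq, Prod.smul_fst, Prod.smul_snd, smul_eq_mul, map_mul]; ring

theorem sesq_zero_left (l : Fin 4 → F) (y : F × F) : sesq σ l 0 y = 0 := by
  simp [sesq_eq]

theorem det₂_add_smul (x y : F × F) (s : F) : det₂ x (y + s • x) = det₂ x y := by
  simp [det₂]; ring

theorem sesq_det (l : Fin 4 → F) (x y : F × F) :
    sesq σ l x x * sesq σ l y y - sesq σ l x y * sesq σ l y x =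
      (l 0 * l 3 - l 1 * l 2) * (det₂ x y * σ (det₂ x y)) := by
  simp only [sesq_eq, det₂, map_sub, map_mul]; ring

theorem exists_det₂_eq_one {x : F × F} (hx : x ≠ 0) : ∃ y, det₂ x y = 1 := by
  obtain ⟨a, b⟩ := x
  rcases eq_or_ne a 0 with rfl | ha
  · have hb : b ≠ 0 := by simpa using hx
    exact ⟨(-b⁻¹, 0), by simp [det₂, hb]⟩
  · exact ⟨(0, a⁻¹), by simp [det₂, ha]⟩

theorem eq_add_smul_of_det₂ {x y z : F × F} (hy : det₂ x y = 1) (hz : det₂ x z = 1) :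
    z = y + det₂ z y • x := by
  simp only [det₂] at *
  ext
  · simp; linear_combination y.1 * hz - z.1 * hy
  · simp; linear_combination y.2 * hz - z.2 * hy

theorem eq_smul_add_smul_of_det₂ {x y : F × F} (h : det₂ x y = 1) (u : F × F) :
    u = det₂ u y • x + det₂ x u • y := by
  simp only [det₂] at *
  ext
  · simp; linear_combination -u.1 * h
  · simp; linear_combination -u.2 * h

theorem eq_smul_of_det₂_eq_zero {x y : F × F} (hx : x ≠ 0) (h : det₂ x y = 0) :
    ∃ t : F, y = t • x := by
  obtain ⟨z, hz⟩ := exists_det₂_eq_one hx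
  refine ⟨-det₂ z y, ?_⟩
  simp only [det₂] at *
  ext
  · simp; linear_combination z.1 * h - y.1 * hz
  · simp; linear_combination z.2 * h - y.2 * hz

/-- The members of the Hermitian pencil obtained from a linear form on the tensor square. -/
def pencil (σ : F →+* F) (l : Fin 4 → F) (c : F) : Fin 4 → F :=
  ![σ c * l 0 - c * σ (l 0), σ c * l 1 - c * σ (l 2), σ c * l 2 - c * σ (l 1),
    σ c * l 3 - c * σ (l 3)]

/-- The quadratic form of the hyperbolic quadric. -/
def quad (v : Fin 4 → F) : F := v 0 * v 3 - v 1 * v 2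

theorem quad_pencil_mul (c : F) (l : Fin 4 → F) {r : F} (hr : σ r = r) :
    quad (pencil σ l (r * c)) = r ^ 2 * quad (pencil σ l c) := by
  simp [quad, pencil, hr]
  ring

theorem quad_pencil_mul_eq_zero (c : F) (l : Fin 4 → F) {r : F} (hr : σ r = r) (hr0 : r ≠ 0) :
    quad (pencil σ l (r * c)) = 0 ↔ quad (pencil σ l c) = 0 := by
  rw [quad_pencil_mul c l hr]
  simp [hr0]

/-- A sesquilinear form with three vanishing Gram entries is a rank one Hermitian multiple. -/
theorem sesq_of_gram_eq_zero (l : Fin 4 → F) {x y : F × F} (hxy : det₂ x y = 1)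
    (hxx : sesq σ l x x = 0) (hx : sesq σ l x y = 0) (hy : sesq σ l y x = 0) (u v : F × F) :
    sesq σ l u v = σ (det₂ x u) * det₂ x v * sesq σ l y y := by
  conv_lhs => rw [eq_smul_add_smul_of_det₂ hxy u, eq_smul_add_smul_of_det₂ hxy v]
  simp only [sesq_add_left, sesq_add_right, sesq_smul_left, sesq_smul_right, hxx, hx, hy]
  ring

theorem herProd_add_left (x y z : F × F) :
    herProd σ (x + y) z = herProd σ x z + herProd σ y z := by
  ext i; fin_cases i <;> simp [herProd, add_mul]

theorem herProd_add_right (x y z : F × F) :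
    herProd σ x (y + z) = herProd σ x y + herProd σ x z := by
  ext i; fin_cases i <;> simp [herProd, mul_add]

theorem herProd_smul_left (t : F) (x y : F × F) :
    herProd σ (t • x) y = σ t • herProd σ x y := by
  ext i; fin_cases i <;> simp [herProd] <;> ring

theorem herProd_smul_right (t : F) (x y : F × F) :
    herProd σ x (t • y) = t • herProd σ x y := by
  ext i; fin_cases i <;> simp [herProd] <;> ring

theorem herProd_smul_add_smul (x y : F × F) (a b c d : F) :
    herProd σ (a • x + b • y) (c • x + d • y) = (σ a * c) • herProd σ x x +
      (σ a * d) • herProd σ x y + (σ b * c) • herProd σ y x + (σ b * d) • herProd σ y y := by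
  simp only [herProd_add_left, herProd_add_right, herProd_smul_left, herProd_smul_right]
  module

/-- The four tensors built from a basis of `F²` are linearly independent. -/
theorem eq_zero_of_herProd_comb {x y : F × F} (hxy : det₂ x y ≠ 0) {a b c d : F}
    (h : a • herProd σ x x + b • herProd σ x y + c • herProd σ y x + d • herProd σ y y = 0) :
    a = 0 ∧ b = 0 ∧ c = 0 ∧ d = 0 := by
  have h0 := congrFun h 0
  have h1 := congrFun h 1
  have h2 := congrFun h 2
  have h3 := congrFun h 3
  simp [herProd] at h0 h1 h2 h3
  have hN : det₂ x y * σ (det₂ x y) ≠ 0 := mul_ne_zero hxy ((map_ne_zero σ).2 hxy)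
  rw [det₂, map_sub, map_mul, map_mul] at hN
  refine ⟨?_, ?_, ?_, ?_⟩ <;> apply mul_left_cancel₀ hN
  · linear_combination σ y.2 * y.2 * h0 - σ y.2 * y.1 * h1 - σ y.1 * y.2 * h2 + σ y.1 * y.1 * h3
  · linear_combination -σ y.2 * x.2 * h0 + σ y.2 * x.1 * h1 + σ y.1 * x.2 * h2 - σ y.1 * x.1 * h3
  · linear_combination -σ x.2 * y.2 * h0 + σ x.2 * y.1 * h1 + σ x.1 * y.2 * h2 - σ x.1 * y.1 * h3
  · linear_combination σ x.2 * x.2 * h0 - σ x.2 * x.1 * h1 - σ x.1 * x.2 * h2 + σ x.1 * x.1 * h3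

theorem exists_eq_smul_add_smul {x y : F × F} (h : det₂ x y ≠ 0) (u : F × F) :
    ∃ a b : F, u = a • x + b • y := by
  refine ⟨det₂ u y / det₂ x y, det₂ x u / det₂ x y, ?_⟩
  simp only [det₂] at *
  ext
  · simp; linear_combination -u.1 * mul_inv_cancel₀ h
  · simp; linear_combination -u.2 * mul_inv_cancel₀ h

theorem det₂_smul_add_smul (x y : F × F) (a b c d : F) :
    det₂ (a • x + b • y) (c • x + d • y) = (a * d - b * c) * det₂ x y := by
  simp [det₂]; ring

theorem det₂_smul_smul (x y : F × F) (a d : F) : det₂ (a • x) (d • y) = a * d * det₂ x y := by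
  simp [det₂]; ring

theorem det₂_comm (x y : F × F) : det₂ y x = -det₂ x y := by
  simp [det₂]; ring

theorem quad_smul (t : F) (v : Fin 4 → F) : quad (t • v) = t ^ 2 * quad v := by
  simp [quad]; ring

theorem quad_herProd (x y : F × F) : quad (herProd σ x y) = 0 := by
  simp [quad, herProd]; ring

theorem quad_hyperbolic (r : F) (x y : F × F) :
    quad (r • herProd σ x x + herProd σ y y) = r * (det₂ x y * σ (det₂ x y)) := by
  simp [quad, herProd, det₂]; ring

theorem quad_elliptic (r : F) (x y : F × F) :
    quad (r • herProd σ x y + herProd σ y x) = -r * (det₂ x y * σ (det₂ x y)) := by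
  simp [quad, herProd, det₂]; ring

/-- The Hermitian form of the surface. -/
def herm (σ : F →+* F) (v : Fin 4 → F) : F :=
  σ (v 0) * v 3 + v 0 * σ (v 3) - v 1 * σ (v 1) - v 2 * σ (v 2)

theorem herm_smul (t : F) (v : Fin 4 → F) : herm σ (t • v) = t * σ t * herm σ v := by
  simp [herm]; ring

theorem herProd_self_ne_zero {x : F × F} (hx : x ≠ 0) : herProd σ x x ≠ 0 := by
  intro H
  obtain ⟨z, hz⟩ := exists_det₂_eq_one hx
  have h1 := eq_zero_of_herProd_comb (σ := σ) (a := 1) (b := 0) (c := 0) (d := 0)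
    (by rw [hz]; exact one_ne_zero) (by rw [H]; module)
  exact one_ne_zero h1.1

theorem hyperbolic_ne_zero (r : F) {x y : F × F} (hxy : det₂ x y ≠ 0) :
    r • herProd σ x x + herProd σ y y ≠ 0 := by
  intro H
  have h1 := eq_zero_of_herProd_comb (σ := σ) (a := r) (b := 0) (c := 0) (d := 1)
    hxy (by rw [← H]; module)
  exact one_ne_zero h1.2.2.2

theorem elliptic_ne_zero (r : F) {x y : F × F} (hxy : det₂ x y ≠ 0) :
    r • herProd σ x y + herProd σ y x ≠ 0 := by
  intro H
  have h1 := eq_zero_of_herProd_comb (σ := σ) (a := 0) (b := r) (c := 1) (d := 0)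
    hxy (by rw [← H]; module)
  exact one_ne_zero h1.2.2.1

theorem mk_mem_iff {K V : Type*} [Field K] [AddCommGroup V] [Module K V] (p : V → Prop)
    (hp : ∀ (t : K) (v : V), t ≠ 0 → (p (t • v) ↔ p v)) (v : V) (hv : v ≠ 0) :
    p (Projectivization.mk K v hv).rep ↔ p v := by
  obtain ⟨a, ha⟩ := Projectivization.exists_smul_eq_mk_rep K v hv
  rw [← ha]
  exact hp a v a.ne_zero

/-- The set of points of `PG(3,q²)` represented by a family of vectors. -/
def pointsOf {α : Type*} (A : Finset α) (g : α → Fin 4 → F) : Set (PGPoint F) :=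
  {P | ∃ a ∈ A, ∃ h : g a ≠ 0, P = Projectivization.mk F (g a) h}

theorem mk_mem_pointsOf {α : Type*} {A : Finset α} {g : α → Fin 4 → F} {v : Fin 4 → F}
    (hv : v ≠ 0) :
    Projectivization.mk F v hv ∈ pointsOf A g ↔ ∃ a ∈ A, ∃ t : F, t ≠ 0 ∧ v = t • g a := by
  constructor
  · rintro ⟨a, ha, hg, H⟩
    obtain ⟨t, ht⟩ := (Projectivization.mk_eq_mk_iff' F _ _ _ _).1 H
    refine ⟨a, ha, t, ?_, ht.symm⟩
    rintro rfl
    exact hv (by rw [← ht, zero_smul])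
  · rintro ⟨a, ha, t, -, rfl⟩
    have hg : g a ≠ 0 := by
      intro H
      rw [H, smul_zero] at hv
      exact hv rfl
    exact ⟨a, ha, hg, (Projectivization.mk_eq_mk_iff' F _ _ _ _).2 ⟨t, rfl⟩⟩

/-- The member of the pencil spanned by `v` and its conjugate. -/
def conjComb (σ : F →+* F) (r s : F) (v : Fin 4 → F) : Fin 4 → F :=
  ![-r * v 0 + s * σ (v 0), -r * v 1 + s * σ (v 2), -r * v 2 + s * σ (v 1),
    -r * v 3 + s * σ (v 3)]

theorem quad_conjComb (r s : F) (v : Fin 4 → F) :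
    quad (conjComb σ r s v) = r ^ 2 * quad v - r * s * herm σ v + s ^ 2 * σ (quad v) := by
  simp [conjComb, quad, herm]
  ring

variable [Fintype F] {q : ℕ} {ξ : F}

/-- `σ` is the involutory Frobenius automorphism of `𝔽_{q²}`, `q` odd, and `ξ` is primitive. -/
structure IsFrobInvolution (q : ℕ) (σ : F →+* F) (ξ : F) : Prop where
  odd : Odd q
  one_lt : 1 < q
  card : Fintype.card F = q ^ 2
  frob : ∀ x, σ x = x ^ q
  prim : IsPrimitiveRoot ξ (q ^ 2 - 1)

namespace IsFrobInvolution

theorem sq_sub_one (h : IsFrobInvolution q σ ξ) : q ^ 2 - 1 = (q + 1) * (q - 1) := by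
  have := h.one_lt
  obtain ⟨r, rfl⟩ : ∃ r, q = r + 1 := ⟨q - 1, by omega⟩
  simp only [Nat.add_sub_cancel]
  rw [Nat.sub_eq_iff_eq_add (by nlinarith)]
  ring

theorem sq_sub_one_pos (h : IsFrobInvolution q σ ξ) : 0 < q ^ 2 - 1 := by
  have := h.one_lt
  rw [h.sq_sub_one]
  exact Nat.mul_pos (by omega) (by omega)

theorem half_mul (h : IsFrobInvolution q σ ξ) : 2 * ((q + 1) / 2) = q + 1 := by
  obtain ⟨r, hr⟩ := h.odd
  omega

theorem sigma_sigma (h : IsFrobInvolution q σ ξ) (x : F) : σ (σ x) = x := by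
  rw [h.frob, h.frob, ← pow_mul, ← sq, ← h.card, FiniteField.pow_card]

theorem xi_ne_zero (h : IsFrobInvolution q σ ξ) : ξ ≠ 0 :=
  h.prim.ne_zero h.sq_sub_one_pos.ne'

theorem two_ne_zero (h : IsFrobInvolution q σ ξ) : (2 : F) ≠ 0 := by
  intro h2
  have h1 := FiniteField.even_card_of_char_two (F := F)
    (by
      have := CharTwo.of_one_ne_zero_of_two_eq_zero one_ne_zero h2
      exact ringChar.eq F 2)
  rw [h.card] at h1
  obtain ⟨r, rfl⟩ := h.odd
  have : (2 * r + 1) ^ 2 = 2 * (2 * r ^ 2 + 2 * r) + 1 := by ring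
  omega

theorem mul_sigma (h : IsFrobInvolution q σ ξ) (x : F) : x * σ x = x ^ (q + 1) := by
  rw [h.frob, pow_succ']

theorem pow_sq_sub_one (h : IsFrobInvolution q σ ξ) {x : F} (hx : x ≠ 0) :
    x ^ (q ^ 2 - 1) = 1 := by
  rw [← h.card]; exact FiniteField.pow_card_sub_one_eq_one x hx

theorem exists_pow (h : IsFrobInvolution q σ ξ) {x : F} (hx : x ≠ 0) : ∃ m, ξ ^ m = x := by
  have : NeZero (q ^ 2 - 1) := ⟨h.sq_sub_one_pos.ne'⟩
  obtain ⟨m, -, hm⟩ := h.prim.eq_pow_of_pow_eq_one (h.pow_sq_sub_one hx)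
  exact ⟨m, hm⟩

theorem card_pow_eq (h : IsFrobInvolution q σ ξ) {d e : ℕ} (hd : q ^ 2 - 1 = d * e)
    {b : F} (hb : b ≠ 0) :
    #{x : F | x ^ e = b ^ e} = e := by
  have hpos := h.sq_sub_one_pos
  have he : 0 < e := by
    rcases Nat.eq_zero_or_pos e with rfl | he
    · omega
    · exact he
  have hp := h.prim.pow hpos hd
  have h1 := hp.card_nthRoots (b ^ e)
  rw [if_pos ⟨b, rfl⟩] at h1
  have h2 : (Polynomial.nthRoots e (b ^ e)).toFinset = ({x : F | x ^ e = b ^ e} : Finset F) := by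
    ext x
    simp [Polynomial.mem_nthRoots he]
  rw [← h2, Multiset.toFinset_card_of_nodup (hp.nthRoots_nodup (pow_ne_zero _ hb)), h1]

theorem card_norm (h : IsFrobInvolution q σ ξ) {a : F} (ha : a ≠ 0) (ha' : σ a = a) :
    #{x : F | x * σ x = a} = q + 1 := by
  obtain ⟨m, rfl⟩ := h.exists_pow ha
  have h1 : ξ ^ (m * (q - 1)) = 1 := by
    rw [h.frob] at ha'
    have : (ξ ^ m) ^ (q - 1) * ξ ^ m = 1 * ξ ^ m := by
      rw [← pow_succ, Nat.sub_add_cancel h.one_lt.le, ha', one_mul]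
    rw [pow_mul]
    exact mul_right_cancel₀ ha this
  rw [h.prim.pow_eq_one_iff_dvd, h.sq_sub_one] at h1
  obtain ⟨c, rfl⟩ := Nat.dvd_of_mul_dvd_mul_right (by have := h.one_lt; omega) h1
  simp_rw [h.mul_sigma]
  rw [mul_comm, pow_mul]
  exact h.card_pow_eq (h.sq_sub_one.trans (mul_comm _ _)) (pow_ne_zero _ h.xi_ne_zero)

theorem sigma_eq_self_iff (h : IsFrobInvolution q σ ξ) {x : F} (hx : x ≠ 0) :
    σ x = x ↔ x ^ (q - 1) = 1 := by
  have : x ^ q = x ^ (q - 1) * x := by rw [← pow_succ, Nat.sub_add_cancel h.one_lt.le]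
  rw [h.frob, this]
  exact ⟨fun H => mul_right_cancel₀ hx (H.trans (one_mul x).symm), fun H => by rw [H, one_mul]⟩

theorem card_fixed_ne_zero (h : IsFrobInvolution q σ ξ) :
    #{x : F | x ≠ 0 ∧ σ x = x} = q - 1 := by
  have h1 := h.card_pow_eq h.sq_sub_one one_ne_zero
  convert h1 using 3 with x
  have := h.one_lt
  rcases eq_or_ne x 0 with rfl | hx
  · simp [zero_pow (show q - 1 ≠ 0 by omega)]
  · simp [hx, h.sigma_eq_self_iff hx]

theorem card_fixed (h : IsFrobInvolution q σ ξ) : #{x : F | σ x = x} = q := by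
  have h1 : ({x : F | σ x = x} : Finset F) = insert 0 ({x : F | x ≠ 0 ∧ σ x = x} : Finset F) := by
    ext x
    rcases eq_or_ne x 0 with rfl | hx <;> simp [*]
  have := h.one_lt
  rw [h1, card_insert_of_notMem (by simp), h.card_fixed_ne_zero]
  omega

/-- The skew element `ξ ^ ((q + 1) / 2)`. -/
theorem sigma_omega (h : IsFrobInvolution q σ ξ) :
    σ (ξ ^ ((q + 1) / 2)) = -ξ ^ ((q + 1) / 2) := by
  have h2 : (ξ ^ ((q + 1) / 2)) ^ (q - 1) = -1 := by
    have h3 : ((ξ ^ ((q + 1) / 2)) ^ (q - 1)) ^ 2 = 1 := by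
      rw [← pow_mul, ← pow_mul, h.prim.pow_eq_one_iff_dvd, h.sq_sub_one]
      apply dvd_of_eq
      rw [mul_comm (q - 1) 2, ← mul_assoc, mul_comm _ 2, h.half_mul]
    rcases sq_eq_one_iff.1 h3 with h4 | h4
    · rw [← pow_mul, h.prim.pow_eq_one_iff_dvd, h.sq_sub_one] at h4
      have h5 := Nat.dvd_of_mul_dvd_mul_right (by have := h.one_lt; omega) h4
      have := Nat.le_of_dvd (by have := h.one_lt; omega) h5
      have := h.one_lt
      omega
    · exact h4
  rw [h.frob]
  calc (ξ ^ ((q + 1) / 2)) ^ q = (ξ ^ ((q + 1) / 2)) ^ (q - 1) * ξ ^ ((q + 1) / 2) := by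
        rw [← pow_succ, Nat.sub_add_cancel h.one_lt.le]
    _ = _ := by rw [h2]; ring

theorem omega_ne_zero (h : IsFrobInvolution q σ ξ) : ξ ^ ((q + 1) / 2) ≠ 0 :=
  pow_ne_zero _ h.xi_ne_zero

theorem card_skew (h : IsFrobInvolution q σ ξ) {β : F} (hβ : β ≠ 0) :
    #{x : F | β * x + σ (β * x) = 0} = q := by
  have ho := h.omega_ne_zero
  have hs := h.sigma_omega
  set ω := ξ ^ ((q + 1) / 2)
  rw [← h.card_fixed]
  apply card_equiv (Equiv.mulLeft₀ (ω * β) (mul_ne_zero ho hβ))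
  intro x
  simp only [mem_filter_univ, Equiv.mulLeft₀_apply, map_mul, hs]
  constructor
  · intro H
    linear_combination -ω * H
  · intro H
    apply mul_left_cancel₀ ho
    linear_combination -H

end IsFrobInvolution

theorem card_filter_prod {α β : Type*} [Fintype α] [Fintype β] (P : α × β → Prop)
    [DecidablePred P] :
    #{x : α × β | P x} = ∑ a, #{b : β | P (a, b)} := by
  simp only [card_filter, Fintype.sum_prod_type]

namespace IsFrobInvolution

theorem sum_eq_of_ne_zero (h : IsFrobInvolution q σ ξ) {f : F → ℕ} {B : ℕ}
    (hf : ∀ b, b ≠ 0 → f b = B) : ∑ b, f b = f 0 + (q ^ 2 - 1) * B := by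
  rw [Fintype.sum_eq_add_sum_compl 0, sum_congr rfl (fun b hb => hf b (by simpa using hb)),
    sum_const, card_compl, h.card]
  simp

theorem sub_one_mul_add (h : IsFrobInvolution q σ ξ) (n : ℕ) :
    (q ^ 2 - 1) * n + n = q ^ 2 * n := by
  rw [← Nat.succ_mul, Nat.succ_eq_add_one,
    Nat.sub_add_cancel (Nat.one_le_pow _ _ h.one_lt.le)]

theorem card_norm_neg_eq (h : IsFrobInvolution q σ ξ) {α β c : F} (hα : α ≠ 0) (hc : σ c = c) :
    #{a : F | (α * a + β) * σ (α * a + β) = c} = if c = 0 then 1 else q + 1 := by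
  have h1 : #{a : F | (α * a + β) * σ (α * a + β) = c} = #{u : F | u * σ u = c} :=
    card_equiv ((Equiv.mulLeft₀ α hα).trans (Equiv.addRight β)) (fun i => by simp)
  rw [h1]
  split_ifs with h0
  · rw [card_eq_one]
    exact ⟨0, by ext x; simp [h0]⟩
  · exact h.card_norm h0 hc

theorem card_hermitian_of_ne_zero (h : IsFrobInvolution q σ ξ) {α β γ : F} (hα : σ α = α)
    (hγ : σ γ = γ) (hα0 : α ≠ 0) :
    #{x : F × F | α * (x.1 * σ x.1) + β * (σ x.1 * x.2) + σ β * (σ x.2 * x.1)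
      + γ * (x.2 * σ x.2) = 0} + (if α * γ = β * σ β then 0 else q)
      = if α * γ = β * σ β then q ^ 2 else q ^ 3 + q ^ 2 := by
  have h1 : #{x : F × F | α * (x.1 * σ x.1) + β * (σ x.1 * x.2) + σ β * (σ x.2 * x.1)
      + γ * (x.2 * σ x.2) = 0} = ∑ b : F, #{a : F | (α * a + β * b) * σ (α * a + β * b) =
        -(α * γ - β * σ β) * (b * σ b)} := by
    rw [card_equiv (t := ({x : F × F | α * (x.2 * σ x.2) + β * (σ x.2 * x.1)
      + σ β * (σ x.1 * x.2) + γ * (x.1 * σ x.1) = 0} : Finset (F × F))) (Equiv.prodComm F F)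
      (fun i => by simp), card_filter_prod]
    refine sum_congr rfl fun b _ => ?_
    congr 1
    ext a
    simp only [mem_filter_univ, map_add, map_mul, hα]
    constructor
    · intro H
      linear_combination α * H
    · intro H
      apply mul_left_cancel₀ hα0
      linear_combination H
  have h2 : ∀ b : F, #{a : F | (α * a + β * b) * σ (α * a + β * b) =
        -(α * γ - β * σ β) * (b * σ b)} = if -(α * γ - β * σ β) * (b * σ b) = 0 then 1 else q + 1 :=
    fun b => h.card_norm_neg_eq hα0 (by
      simp only [map_neg, map_mul, map_sub, hα, hγ, h.sigma_sigma]
      ring)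
  rw [h1]
  simp only [h2]
  rw [h.sum_eq_of_ne_zero (B := if α * γ = β * σ β then 1 else q + 1)]
  · have := h.sub_one_mul_add 1
    have := h.sub_one_mul_add q
    rw [if_pos (by simp)]
    split_ifs
    · omega
    · ring_nf at *
      omega
  · intro b hb
    simp only [mul_eq_zero, neg_eq_zero, sub_eq_zero, hb, (map_eq_zero σ), or_false]

theorem card_hermitian (h : IsFrobInvolution q σ ξ) {α β γ : F} (hα : σ α = α)
    (hγ : σ γ = γ) (h0 : ¬ (α = 0 ∧ β = 0 ∧ γ = 0)) :
    #{x : F × F | α * (x.1 * σ x.1) + β * (σ x.1 * x.2) + σ β * (σ x.2 * x.1)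
      + γ * (x.2 * σ x.2) = 0} + (if α * γ = β * σ β then 0 else q)
      = if α * γ = β * σ β then q ^ 2 else q ^ 3 + q ^ 2 := by
  rcases ne_or_eq α 0 with hα0 | rfl
  · exact h.card_hermitian_of_ne_zero hα hγ hα0
  rcases ne_or_eq γ 0 with hγ0 | rfl
  · have h1 := h.card_hermitian_of_ne_zero (β := σ β) hγ hα hγ0
    rw [h.sigma_sigma, mul_comm γ, mul_comm (σ β)] at h1
    rw [← h1]
    congr 1
    apply card_equiv (Equiv.prodComm F F)
    intro i
    simp only [mem_filter_univ, Equiv.prodComm_apply, Prod.fst_swap, Prod.snd_swap]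
    constructor <;> intro H <;> linear_combination H
  · have hβ : β ≠ 0 := by tauto
    have hN : ¬ (0 * 0 = β * σ β) := by simp [hβ]
    rw [if_neg hN, if_neg hN, card_filter_prod, h.sum_eq_of_ne_zero (B := q)]
    · have := h.sub_one_mul_add q
      simp [h.card]
      ring_nf at *
      omega
    · intro a ha
      rw [← h.card_skew (mul_ne_zero hβ ((map_ne_zero σ).2 ha))]
      congr 1
      ext b
      simp only [mem_filter_univ, map_mul, h.sigma_sigma]
      constructor <;> intro H <;> linear_combination H

end IsFrobInvolution

/-- Vectors at determinant one from `x ≠ 0` form an affine line. -/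
theorem card_det₂_eq_one {x y : F × F} (hy : det₂ x y = 1) (P : F × F → Prop)
    [DecidablePred P] :
    #{z : F × F | det₂ x z = 1 ∧ P z} = #{s : F | P (y + s • x)} := by
  symm
  apply card_nbij' (fun s => y + s • x) (fun z => det₂ z y)
  · intro s hs
    simp only [coe_filter, mem_univ, true_and, Set.mem_ofPred_eq] at hs ⊢
    exact ⟨(det₂_add_smul x y s).trans hy, hs⟩
  · intro z hz
    simp only [coe_filter, mem_univ, true_and, Set.mem_ofPred_eq] at hz ⊢
    rw [← eq_add_smul_of_det₂ hy hz.1]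
    exact hz.2
  · intro s hs
    simp only [det₂, Prod.fst_add, Prod.snd_add, Prod.smul_fst, Prod.smul_snd, smul_eq_mul] at hy ⊢
    linear_combination s * hy
  · intro z hz
    simp only [coe_filter, mem_univ, true_and, Set.mem_ofPred_eq] at hz
    exact (eq_add_smul_of_det₂ hy hz.1).symm

namespace IsFrobInvolution

theorem card_twisted_linear {ρ T g : F} (h : IsFrobInvolution q σ ξ) (hρ : ρ * σ ρ ≠ 1)
    (hT : T ≠ 0) : #{s : F | (ρ * s + σ s) * T + g = 0} = 1 := by
  have hinj : Function.Injective (fun s => (ρ * s + σ s) * T + g) := by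
    intro s t hst
    have h1 : ρ * (s - t) = -σ (s - t) := by
      rw [map_sub]
      apply mul_right_cancel₀ hT
      linear_combination hst
    have h2 : σ ρ * σ (s - t) = -(s - t) := by
      have := congrArg σ h1
      rwa [map_neg, h.sigma_sigma, map_mul] at this
    have h3 : (ρ * σ ρ - 1) * ((s - t) * σ (s - t)) = 0 := by
      linear_combination σ ρ * σ (s - t) * h1 - σ (s - t) * h2
    by_contra hne
    have h4 : s - t ≠ 0 := sub_ne_zero.2 hne
    exact mul_ne_zero (sub_ne_zero.2 hρ) (mul_ne_zero h4 ((map_ne_zero σ).2 h4)) h3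
  obtain ⟨s, hs⟩ := (Finite.injective_iff_surjective.1 hinj) 0
  rw [card_eq_one]
  refine ⟨s, ?_⟩
  ext t
  simp only [mem_filter_univ, mem_singleton]
  exact ⟨fun ht => hinj (ht.trans hs.symm), fun ht => ht ▸ hs⟩

theorem card_elliptic (h : IsFrobInvolution q σ ξ) {ρ : F} (hρ : ρ * σ ρ ≠ 1) (l : Fin 4 → F) :
    #{z : (F × F) × (F × F) | det₂ z.1 z.2 = 1 ∧ ρ * sesq σ l z.1 z.2 + sesq σ l z.2 z.1 = 0} =
      #{x : F × F | sesq σ l x x ≠ 0} + q ^ 2 * #{x : F × F | sesq σ l x x = 0 ∧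
        ∃ y, det₂ x y = 1 ∧ ρ * sesq σ l x y + sesq σ l y x = 0} := by
  rw [card_filter_prod]
  simp only [card_filter (fun x : F × F => sesq σ l x x ≠ 0),
    card_filter (fun x : F × F => sesq σ l x x = 0 ∧ _), mul_sum, ← sum_add_distrib]
  refine sum_congr rfl fun x _ => ?_
  rcases eq_or_ne x 0 with rfl | hx
  · simp [det₂, sesq_zero_left]
  obtain ⟨y, hy⟩ := exists_det₂_eq_one hx
  rw [card_det₂_eq_one hy]
  have key : ∀ s : F, ρ * sesq σ l x (y + s • x) + sesq σ l (y + s • x) x =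
      (ρ * s + σ s) * sesq σ l x x + (ρ * sesq σ l x y + sesq σ l y x) := by
    intro s
    rw [sesq_add_right, sesq_add_left, sesq_smul_left, sesq_smul_right]
    ring
  simp only [key]
  by_cases hT : sesq σ l x x = 0
  · have hex : (∃ z, det₂ x z = 1 ∧ ρ * sesq σ l x z + sesq σ l z x = 0) ↔
        ρ * sesq σ l x y + sesq σ l y x = 0 := by
      constructor
      · rintro ⟨z, hz, hz'⟩
        rw [eq_add_smul_of_det₂ hy hz, key, hT] at hz'
        simpa using hz'
      · exact fun H => ⟨y, hy, H⟩
    by_cases hc : ρ * sesq σ l x y + sesq σ l y x = 0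
    · simp [hT, hex, hc, h.card]
    · simp [hT, hex, hc]
  · rw [h.card_twisted_linear hρ hT]
    simp [hT]

end IsFrobInvolution

theorem card_det₂_eq_zero {x : F × F} (hx : x ≠ 0) (P : F × F → Prop) [DecidablePred P] :
    #{y : F × F | det₂ x y = 0 ∧ P y} = #{t : F | P (t • x)} := by
  symm
  apply card_nbij (fun t => t • x)
  · intro t ht
    simp only [coe_filter, mem_univ, true_and, Set.mem_ofPred_eq] at ht ⊢
    exact ⟨by simp [det₂]; ring, ht⟩
  · intro s _ t _ hst
    exact smul_left_injective F hx hst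
  · intro y hy
    simp only [coe_filter, mem_univ, true_and, Set.mem_ofPred_eq] at hy
    obtain ⟨t, rfl⟩ := eq_smul_of_det₂_eq_zero hx hy.1
    exact ⟨t, by simpa using hy.2, rfl⟩

/-- The number of nonzero vectors at which the diagonal of a sesquilinear form vanishes. -/
def isotropicCard (σ : F →+* F) (l : Fin 4 → F) : ℕ :=
  #{x : F × F | x ≠ 0 ∧ sesq σ l x x = 0}

theorem card_sesq_eq_zero (l : Fin 4 → F) :
    #{x : F × F | sesq σ l x x = 0} = isotropicCard σ l + 1 := by
  have h1 : ({x : F × F | sesq σ l x x = 0} : Finset (F × F)) =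
      insert 0 ({x : F × F | x ≠ 0 ∧ sesq σ l x x = 0} : Finset (F × F)) := by
    ext x
    rcases eq_or_ne x 0 with rfl | hx
    · simp [sesq_zero_left]
    · simp [hx]
  rw [h1, card_insert_of_notMem (by simp), isotropicCard]

namespace IsFrobInvolution

theorem card_sesq_ne_zero (h : IsFrobInvolution q σ ξ) (l : Fin 4 → F) :
    #{x : F × F | sesq σ l x x ≠ 0} + (isotropicCard σ l + 1) = q ^ 4 := by
  rw [← card_sesq_eq_zero, add_comm, card_filter_add_card_filter_not, card_univ,
    Fintype.card_prod, h.card]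
  ring

theorem sigma_ne_neg_omega (h : IsFrobInvolution q σ ξ) (t : F) :
    ξ ^ ((q + 1) / 2) + t * σ t ≠ 0 := by
  intro H
  have h1 := congrArg σ H
  simp only [map_add, map_mul, map_zero, h.sigma_sigma, h.sigma_omega] at h1
  have h2 : 2 * ξ ^ ((q + 1) / 2) = 0 := by linear_combination H - h1
  exact mul_ne_zero h.two_ne_zero h.omega_ne_zero h2

theorem card_hyperbolic (h : IsFrobInvolution q σ ξ) (l : Fin 4 → F) :
    #{z : (F × F) × (F × F) | det₂ z.1 z.2 ≠ 0 ∧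
      ξ ^ ((q + 1) / 2) * sesq σ l z.1 z.1 + sesq σ l z.2 z.2 = 0} +
        q ^ 2 * isotropicCard σ l =
      isotropicCard σ l ^ 2 + isotropicCard σ l + ∑ c ∈ ({c : F | c ≠ 0} : Finset F),
        #{x : F × F | sesq σ l x x = c} *
          #{x : F × F | sesq σ l x x = -(ξ ^ ((q + 1) / 2) * c)} := by
  set ω := ξ ^ ((q + 1) / 2) with hω
  have hall : #{z : (F × F) × (F × F) | ω * sesq σ l z.1 z.1 + sesq σ l z.2 z.2 = 0} =
      (isotropicCard σ l + 1) ^ 2 + ∑ c ∈ ({c : F | c ≠ 0} : Finset F),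
        #{x : F × F | sesq σ l x x = c} * #{x : F × F | sesq σ l x x = -(ω * c)} := by
    rw [card_filter_prod, ← sum_fiberwise univ (fun x => sesq σ l x x),
      Fintype.sum_eq_add_sum_compl 0]
    congr 1
    · rw [sum_congr rfl (g := fun _ => isotropicCard σ l + 1), sum_const, card_sesq_eq_zero]
      · simp [sq]
      · intro x hx
        simp only [mem_filter_univ] at hx
        simp only [hx, mul_zero, zero_add, card_sesq_eq_zero]
    · refine sum_congr (by ext; simp) fun c _ => ?_
      rw [← smul_eq_mul, ← sum_const]
      refine sum_congr rfl fun x hx => ?_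
      simp only [mem_filter_univ] at hx
      congr 1
      ext y
      simp only [mem_filter_univ, hx]
      rw [add_comm, add_eq_zero_iff_eq_neg]
  have hdep : #{z : (F × F) × (F × F) | det₂ z.1 z.2 = 0 ∧
      ω * sesq σ l z.1 z.1 + sesq σ l z.2 z.2 = 0} =
      (isotropicCard σ l + 1) + q ^ 2 * isotropicCard σ l := by
    have hz : q ^ 2 * isotropicCard σ l =
        ∑ x : F × F, q ^ 2 * (if x ≠ 0 ∧ sesq σ l x x = 0 then 1 else 0) := by
      rw [isotropicCard, card_filter, mul_sum]
    rw [card_filter_prod, hz, ← Fintype.sum_ite_eq' (0 : F × F)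
      (fun _ => isotropicCard σ l + 1), ← sum_add_distrib]
    refine sum_congr rfl fun x _ => ?_
    rcases eq_or_ne x 0 with rfl | hx
    · simp [det₂, sesq_zero_left, card_sesq_eq_zero]
    · rw [card_det₂_eq_zero hx]
      have key : ∀ t : F, ω * sesq σ l x x + sesq σ l (t • x) (t • x) = 0 ↔ sesq σ l x x = 0 := by
        intro t
        have hfac : ω * sesq σ l x x + sesq σ l (t • x) (t • x) =
            (ω + t * σ t) * sesq σ l x x := by
          rw [sesq_smul_left, sesq_smul_right]
          ring
        rw [hfac, mul_eq_zero_iff_left (h.sigma_ne_neg_omega t)]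
      simp only [key]
      by_cases hT : sesq σ l x x = 0 <;> simp [hx, hT, h.card]
  have hsplit : #{z : (F × F) × (F × F) | det₂ z.1 z.2 ≠ 0 ∧
      ω * sesq σ l z.1 z.1 + sesq σ l z.2 z.2 = 0} + #{z : (F × F) × (F × F) | det₂ z.1 z.2 = 0 ∧
      ω * sesq σ l z.1 z.1 + sesq σ l z.2 z.2 = 0} =
      #{z : (F × F) × (F × F) | ω * sesq σ l z.1 z.1 + sesq σ l z.2 z.2 = 0} := by
    simp only [card_filter, ← sum_add_distrib]
    refine sum_congr rfl fun z _ => ?_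
    by_cases hz : det₂ z.1 z.2 = 0 <;> simp [hz]
  have : (isotropicCard σ l + 1) ^ 2 = isotropicCard σ l ^ 2 + 2 * isotropicCard σ l + 1 := by ring
  omega

theorem sesq_pencil (h : IsFrobInvolution q σ ξ) (l : Fin 4 → F) (c : F) (x y : F × F) :
    sesq σ (pencil σ l c) x y = σ c * sesq σ l x y - c * σ (sesq σ l y x) := by
  simp [sesq_eq, pencil, h.sigma_sigma]
  ring

theorem card_sesq_norm_mul (c : F) (l : Fin 4 → F) {t : F} (ht : t ≠ 0) :
    #{x : F × F | sesq σ l x x = t * σ t * c} = #{x : F × F | sesq σ l x x = c} := by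
  symm
  apply card_equiv (MulAction.toPerm (Units.mk0 t ht))
  intro x
  simp only [mem_filter_univ, MulAction.toPerm_apply, Units.smul_mk0, sesq_smul_left,
    sesq_smul_right]
  have h0 : t * σ t ≠ 0 := mul_ne_zero ht ((map_ne_zero σ).2 ht)
  constructor
  · intro H
    linear_combination t * σ t * H
  · intro H
    apply mul_left_cancel₀ h0
    linear_combination H

theorem card_sesq_mul (h : IsFrobInvolution q σ ξ) (c : F) (l : Fin 4 → F) {r : F}
    (hr : σ r = r) (hr0 : r ≠ 0) :
    #{x : F × F | sesq σ l x x = r * c} = #{x : F × F | sesq σ l x x = c} := by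
  have h1 := h.card_norm hr0 hr
  obtain ⟨t, ht⟩ := card_pos.1 (h1.ge.trans_lt' (Nat.succ_pos q))
  rw [mem_filter_univ] at ht
  rw [← ht, card_sesq_norm_mul]
  rintro rfl
  simp [hr0.symm] at ht

theorem card_pencil (h : IsFrobInvolution q σ ξ) (l : Fin 4 → F) {c : F} (hc : c ≠ 0) :
    #{x : F × F | sesq σ (pencil σ l c) x x = 0} =
      isotropicCard σ l + 1 + (q - 1) * #{x : F × F | sesq σ l x x = c} := by
  have hc' : σ c ≠ 0 := (map_ne_zero σ).2 hc
  have h1 : ∀ x ∈ ({x : F × F | sesq σ (pencil σ l c) x x = 0} : Finset (F × F)),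
      sesq σ l x x / c ∈ ({r : F | σ r = r} : Finset F) := by
    intro x hx
    simp only [mem_filter_univ, h.sesq_pencil, map_div₀] at hx ⊢
    field_simp
    linear_combination -hx
  have h2 : ({r : F | σ r = r} : Finset F) = insert 0 ({r : F | r ≠ 0 ∧ σ r = r} : Finset F) := by
    ext x
    rcases eq_or_ne x 0 with rfl | hx <;> simp [*]
  have h3 : ∀ r : F, σ r = r → #{x ∈ ({x : F × F | sesq σ (pencil σ l c) x x = 0} :
      Finset (F × F)) | sesq σ l x x / c = r} = #{x : F × F | sesq σ l x x = r * c} := by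
    intro r hr
    congr 1
    ext x
    simp only [mem_filter, mem_univ, true_and, h.sesq_pencil, div_eq_iff hc]
    constructor
    · exact And.right
    · intro H
      refine ⟨?_, H⟩
      rw [H, map_mul, hr]
      ring
  rw [card_eq_sum_card_fiberwise h1, h2, sum_insert (by simp), h3 0 (map_zero σ), zero_mul,
    card_sesq_eq_zero, sum_congr rfl (g := fun _ => #{x : F × F | sesq σ l x x = c}), sum_const,
    h.card_fixed_ne_zero, smul_eq_mul]
  intro r hr
  rw [mem_filter_univ] at hr
  rw [h3 r hr.2, h.card_sesq_mul c l hr.2 hr.1]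

theorem card_sesq_eq (h : IsFrobInvolution q σ ξ) (l : Fin 4 → F) {c : F} (hc : c ≠ 0)
    (hl : pencil σ l c ≠ 0) :
    isotropicCard σ l + 1 + (q - 1) * #{x : F × F | sesq σ l x x = c} +
      (if quad (pencil σ l c) = 0 then 0 else q) =
      if quad (pencil σ l c) = 0 then q ^ 2 else q ^ 3 + q ^ 2 := by
  have ho := h.omega_ne_zero
  have hs := h.sigma_omega
  set ω := ξ ^ ((q + 1) / 2)
  have h0 : σ (ω * pencil σ l c 0) = ω * pencil σ l c 0 := by
    simp [pencil, hs, h.sigma_sigma]; ring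
  have h3 : σ (ω * pencil σ l c 3) = ω * pencil σ l c 3 := by
    simp [pencil, hs, h.sigma_sigma]; ring
  have h1 : σ (ω * pencil σ l c 1) = ω * pencil σ l c 2 := by
    simp [pencil, hs, h.sigma_sigma]; ring
  have hiff : (ω * pencil σ l c 0) * (ω * pencil σ l c 3) =
      (ω * pencil σ l c 1) * σ (ω * pencil σ l c 1) ↔ quad (pencil σ l c) = 0 := by
    rw [h1, ← sub_eq_zero, ← mul_eq_zero_iff_left (b := quad (pencil σ l c)) (mul_ne_zero ho ho),
      quad]
    constructor <;> intro H <;> linear_combination H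
  have key := h.card_hermitian (β := ω * pencil σ l c 1) h0 h3 (by
    rintro ⟨e0, e1, e3⟩
    rw [e1, map_zero] at h1
    apply hl
    funext i
    fin_cases i
    · exact (mul_eq_zero.1 e0).resolve_left ho
    · exact (mul_eq_zero.1 e1).resolve_left ho
    · exact (mul_eq_zero.1 h1.symm).resolve_left ho
    · exact (mul_eq_zero.1 e3).resolve_left ho)
  simp only [hiff] at key
  rw [← h.card_pencil l hc, ← key]
  congr 2
  ext x
  rw [mem_filter_univ, mem_filter_univ, ← mul_eq_zero_iff_left (b := sesq σ _ x x) ho, sesq_eq, h1]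
  constructor <;> intro H <;> linear_combination H

theorem natCast_card_sesq_eq (h : IsFrobInvolution q σ ξ) {l : Fin 4 → F} {c₀ : ℕ}
    (hz : isotropicCard σ l = (q ^ 2 - 1) * c₀) {c : F} (hc : c ≠ 0) (hl : pencil σ l c ≠ 0) :
    (#{x : F × F | sesq σ l x x = c} : ℤ) =
      (q + 1) * (q + 1 - c₀) - q * (q + 1) * if quad (pencil σ l c) = 0 then 1 else 0 := by
  have h1 := h.card_sesq_eq l hc hl
  have hq := h.one_lt
  rw [hz, h.sq_sub_one] at h1
  have hq0 : ((q : ℤ) - 1) ≠ 0 := by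
    have : (1 : ℤ) < q := by exact_mod_cast hq
    omega
  apply mul_left_cancel₀ hq0
  split_ifs at h1 ⊢
  · zify [hq.le] at h1
    linear_combination h1
  · zify [hq.le] at h1
    linear_combination h1

theorem natCast_card_ne_zero (h : IsFrobInvolution q σ ξ) :
    (#({c : F | c ≠ 0} : Finset F) : ℤ) = q ^ 2 - 1 := by
  rw [filter_ne', card_erase_of_mem (mem_univ _), card_univ, h.card,
    Nat.cast_sub (Nat.one_le_pow _ _ h.one_lt.le)]
  simp

theorem sum_card_sesq_eq (h : IsFrobInvolution q σ ξ) (l : Fin 4 → F) :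
    isotropicCard σ l + 1 + ∑ c ∈ ({c : F | c ≠ 0} : Finset F), #{x : F × F | sesq σ l x x = c} =
      q ^ 4 := by
  rw [← h.card_sesq_ne_zero l, add_comm]
  congr 1
  rw [card_eq_sum_card_fiberwise (f := fun x => sesq σ l x x) (t := ({c : F | c ≠ 0} : Finset F))]
  · refine sum_congr rfl fun c hc => ?_
    rw [mem_filter_univ] at hc
    congr 1
    ext x
    simp only [mem_filter, mem_univ, true_and]
    exact ⟨fun H => ⟨H ▸ hc, H⟩, And.right⟩
  · intro x hx
    simpa using hx

/-- The number of degenerate members of the Hermitian pencil. -/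
theorem natCast_card_degenerate (h : IsFrobInvolution q σ ξ) {l : Fin 4 → F} {c₀ : ℕ}
    (hz : isotropicCard σ l = (q ^ 2 - 1) * c₀) (hl : ∀ c, c ≠ 0 → pencil σ l c ≠ 0) :
    (#{c : F | c ≠ 0 ∧ quad (pencil σ l c) = 0} : ℤ) = (q - 1) * (2 - c₀) := by
  have h1 := h.sum_card_sesq_eq l
  have hq : (1 : ℤ) < q := by exact_mod_cast h.one_lt
  rw [hz, h.sq_sub_one] at h1
  zify [h.one_lt.le] at h1
  rw [sum_congr rfl fun c hc => h.natCast_card_sesq_eq hz (mem_filter_univ c |>.1 hc)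
    (hl c (mem_filter_univ c |>.1 hc)), sum_sub_distrib, sum_const, ← mul_sum, sum_boole,
    filter_filter, nsmul_eq_mul, h.natCast_card_ne_zero] at h1
  apply mul_left_cancel₀ (show (q : ℤ) * (q + 1) ≠ 0 by positivity)
  linear_combination -h1

theorem card_degenerate_omega_mul (h : IsFrobInvolution q σ ξ) (l : Fin 4 → F) :
    #{c : F | c ≠ 0 ∧ quad (pencil σ l (-(ξ ^ ((q + 1) / 2) * c))) = 0} =
      #{c : F | c ≠ 0 ∧ quad (pencil σ l c) = 0} := by
  apply card_equiv (Equiv.mulLeft₀ (-ξ ^ ((q + 1) / 2)) (neg_ne_zero.2 h.omega_ne_zero))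
  intro c
  simp [h.xi_ne_zero]

theorem sum_card_sesq_mul (h : IsFrobInvolution q σ ξ) {l : Fin 4 → F} {c₀ : ℕ}
    (hz : isotropicCard σ l = (q ^ 2 - 1) * c₀) (hl : ∀ c, c ≠ 0 → pencil σ l c ≠ 0) :
    (((∑ c ∈ ({c : F | c ≠ 0} : Finset F), #{x : F × F | sesq σ l x x = c} *
      #{x : F × F | sesq σ l x x = -(ξ ^ ((q + 1) / 2) * c)} : ℕ)) : ℤ) =
      ((q + 1) * (q + 1 - c₀)) ^ 2 * (q ^ 2 - 1)
      - 2 * ((q + 1) * (q + 1 - c₀)) * (q * (q + 1)) * ((q - 1) * (2 - c₀))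
      + (q * (q + 1)) ^ 2 * #{c : F | c ≠ 0 ∧ (quad (pencil σ l c) = 0 ∧
          quad (pencil σ l (-(ξ ^ ((q + 1) / 2) * c))) = 0)} := by
  have ho := h.omega_ne_zero
  have h2 := h.card_degenerate_omega_mul l
  set ω := ξ ^ ((q + 1) / 2)
  have h1 : ∀ c ∈ ({c : F | c ≠ 0} : Finset F), ((#{x : F × F | sesq σ l x x = c} *
      #{x : F × F | sesq σ l x x = -(ω * c)} : ℕ) : ℤ) =
      ((q + 1) * (q + 1 - c₀)) ^ 2
      - ((q + 1) * (q + 1 - c₀)) * (q * (q + 1)) * (if quad (pencil σ l c) = 0 then 1 else 0)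
      - ((q + 1) * (q + 1 - c₀)) * (q * (q + 1)) *
        (if quad (pencil σ l (-(ω * c))) = 0 then 1 else 0)
      + (q * (q + 1)) ^ 2 * (if quad (pencil σ l c) = 0 ∧ quad (pencil σ l (-(ω * c))) = 0
        then 1 else 0) := by
    intro c hc
    rw [mem_filter_univ] at hc
    have hc' : -(ω * c) ≠ 0 := neg_ne_zero.2 (mul_ne_zero ho hc)
    rw [Nat.cast_mul, h.natCast_card_sesq_eq hz hc (hl c hc),
      h.natCast_card_sesq_eq hz hc' (hl _ hc')]
    by_cases e1 : quad (pencil σ l c) = 0 <;>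
      by_cases e2 : quad (pencil σ l (-(ω * c))) = 0 <;> simp only [e1, e2] <;> simp <;> ring
  rw [Nat.cast_sum, sum_congr rfl h1, sum_add_distrib, sum_sub_distrib, sum_sub_distrib,
    ← mul_sum, ← mul_sum, ← mul_sum, sum_boole, sum_boole, sum_boole, filter_filter,
    filter_filter, filter_filter, h2, h.natCast_card_degenerate hz hl, sum_const, nsmul_eq_mul,
    h.natCast_card_ne_zero]
  ring

/-- Degenerate pairs related by the skew element force the pencil to have two orbits of them. -/
theorem card_degenerate_pairs (h : IsFrobInvolution q σ ξ) {l : Fin 4 → F} {c₀ : ℕ}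
    (hz : isotropicCard σ l = (q ^ 2 - 1) * c₀) (hl : ∀ c, c ≠ 0 → pencil σ l c ≠ 0) :
    #{c : F | c ≠ 0 ∧ (quad (pencil σ l c) = 0 ∧
      quad (pencil σ l (-(ξ ^ ((q + 1) / 2) * c))) = 0)} = 0 ∨
    #{c : F | c ≠ 0 ∧ (quad (pencil σ l c) = 0 ∧
      quad (pencil σ l (-(ξ ^ ((q + 1) / 2) * c))) = 0)} = 2 * (q - 1) ∧ c₀ = 0 := by
  have ho := h.omega_ne_zero
  have hs := h.sigma_omega
  set ω := ξ ^ ((q + 1) / 2)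
  set J := ({c : F | c ≠ 0 ∧ (quad (pencil σ l c) = 0 ∧ quad (pencil σ l (-(ω * c))) = 0)} :
    Finset F) with hJ
  have hD := h.natCast_card_degenerate hz hl
  have hJD : #J ≤ #{c : F | c ≠ 0 ∧ quad (pencil σ l c) = 0} :=
    card_le_card fun c hc => by
      simp only [hJ, mem_filter_univ] at hc ⊢
      exact ⟨hc.1, hc.2.1⟩
  rcases J.eq_empty_or_nonempty with h0 | ⟨c, hc⟩
  · left
    rw [h0, card_empty]
  right
  have hc0 : c ≠ 0 := ((mem_filter_univ c).1 hc).1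
  have hmul : ∀ c ∈ J, ∀ r : F, r ≠ 0 → σ r = r → r * c ∈ J := by
    intro c hc r hr0 hr
    simp only [hJ, mem_filter_univ] at hc ⊢
    refine ⟨mul_ne_zero hr0 hc.1, (quad_pencil_mul_eq_zero c l hr hr0).2 hc.2.1, ?_⟩
    rw [show -(ω * (r * c)) = r * -(ω * c) by ring]
    exact (quad_pencil_mul_eq_zero _ l hr hr0).2 hc.2.2
  have hω : -(ω * c) ∈ J := by
    simp only [hJ, mem_filter_univ] at hc ⊢
    refine ⟨neg_ne_zero.2 (mul_ne_zero ho hc.1), hc.2.2, ?_⟩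
    rw [show -(ω * -(ω * c)) = ω ^ 2 * c by ring]
    exact (quad_pencil_mul_eq_zero c l (by rw [map_pow, hs]; ring) (pow_ne_zero 2 ho)).2 hc.2.1
  set R := ({r : F | r ≠ 0 ∧ σ r = r} : Finset F) with hR
  have hsub : R.image (fun r => r * c) ∪ R.image (fun r => r * -(ω * c)) ⊆ J := by
    intro d hd
    simp only [mem_union, mem_image, hR, mem_filter_univ] at hd
    rcases hd with ⟨r, hr, rfl⟩ | ⟨r, hr, rfl⟩
    · exact hmul c hc r hr.1 hr.2
    · exact hmul _ hω r hr.1 hr.2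
  have hdisj : Disjoint (R.image fun r => r * c) (R.image fun r => r * -(ω * c)) := by
    rw [disjoint_left]
    intro d hd hd'
    simp only [mem_image, hR, mem_filter_univ] at hd hd'
    obtain ⟨r, hr, rfl⟩ := hd
    obtain ⟨t, ht, e⟩ := hd'
    have e1 : r = -(t * ω) := mul_right_cancel₀ hc0 (by linear_combination -e)
    have e2 := hr.2
    rw [e1, map_neg, map_mul, hs, ht.2] at e2
    have e3 : 2 * (t * ω) = 0 := by linear_combination e2
    exact mul_ne_zero h.two_ne_zero (mul_ne_zero ht.1 ho) e3
  have hle := card_le_card hsub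
  rw [card_union_of_disjoint hdisj, card_image_of_injective _ (mul_left_injective₀ hc0),
    card_image_of_injective _ (mul_left_injective₀ (neg_ne_zero.2 (mul_ne_zero ho hc0))), hR,
    h.card_fixed_ne_zero] at hle
  have hq := h.one_lt
  have hc₀ : c₀ = 0 := by
    by_contra hne
    have h1 : (1 : ℤ) ≤ c₀ := by exact_mod_cast Nat.one_le_iff_ne_zero.2 hne
    have h2 := hle.trans hJD
    zify [hq.le] at h2
    rw [hD] at h2
    have h3 : (1 : ℤ) < q := by exact_mod_cast hq
    nlinarith
  refine ⟨?_, hc₀⟩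
  rw [hc₀] at hD
  zify [hq.le] at hle hJD ⊢
  rw [hD] at hJD
  push_cast at hJD
  linarith

theorem exists_pencil_eq_zero_of_gram (h : IsFrobInvolution q σ ξ) (l : Fin 4 → F) {x y : F × F}
    (hxy : det₂ x y = 1) (hxx : sesq σ l x x = 0) (hx : sesq σ l x y = 0)
    (hy : sesq σ l y x = 0) : ∃ c, c ≠ 0 ∧ pencil σ l c = 0 := by
  have key := sesq_of_gram_eq_zero l hxy hxx hx hy
  have h0 := key (1, 0) (1, 0)
  have h1 := key (1, 0) (0, 1)
  have h2 := key (0, 1) (1, 0)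
  have h3 := key (0, 1) (0, 1)
  set T := sesq σ l y y
  simp [sesq_eq, det₂] at h0 h1 h2 h3
  rcases eq_or_ne T 0 with hT | hT
  · refine ⟨1, one_ne_zero, ?_⟩
    funext i
    fin_cases i <;> simp [pencil, h0, h1, h2, h3, hT]
  · refine ⟨T, hT, ?_⟩
    funext i
    fin_cases i <;> simp [pencil, h0, h1, h2, h3, h.sigma_sigma] <;> ring

theorem pow_two_mul_sub_one_eq_one_iff (h : IsFrobInvolution q σ ξ) {a : F} (ha : a ≠ 0) :
    a ^ (2 * (q - 1)) = 1 ↔ σ a ^ 2 = a ^ 2 := by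
  have : σ a ^ 2 = a ^ (2 * (q - 1)) * a ^ 2 := by
    rw [h.frob, ← pow_add, ← pow_mul]
    congr 1
    have := h.one_lt
    omega
  rw [this]
  exact ⟨fun H => by rw [H, one_mul], fun H => mul_right_cancel₀ (pow_ne_zero 2 ha)
    (H.trans (one_mul _).symm)⟩

theorem exists_smul_of_elliptic (h : IsFrobInvolution q σ ξ) {ρ : F} (hρ : ρ * σ ρ ≠ 1)
    (hρ0 : ρ ≠ 0) (l : Fin 4 → F) {x y x' y' : F × F} (hxy : det₂ x y = 1)
    (hxx : sesq σ l x x = 0) (hx : ρ * sesq σ l x y + sesq σ l y x = 0) (hA : sesq σ l x y ≠ 0)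
    (hxy' : det₂ x' y' = 1) (hxx' : sesq σ l x' x' = 0)
    (hx' : ρ * sesq σ l x' y' + sesq σ l y' x' = 0) :
    ∃ a : F, a ^ (2 * (q - 1)) = 1 ∧ x' = a • x := by
  have hB : sesq σ l y x = -(ρ * sesq σ l x y) := by linear_combination hx
  have hexp := eq_smul_add_smul_of_det₂ hxy x'
  set a := det₂ x' y with ha
  set b := det₂ x x' with hb
  have hTx' : ∀ s : F, sesq σ l x' (s • x') = 0 := fun s => by rw [sesq_smul_right, hxx', mul_zero]
  rcases eq_or_ne b 0 with hb0 | hb0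
  · rw [hb0, zero_smul, add_zero] at hexp
    have ha0 : a ≠ 0 := by
      intro h0
      rw [hexp, h0] at hxy'
      simp [det₂] at hxy'
    refine ⟨a, ?_, hexp⟩
    rw [h.pow_two_mul_sub_one_eq_one_iff ha0]
    have hσa : σ a ≠ 0 := (map_ne_zero σ).2 ha0
    have hd : det₂ x' (a⁻¹ • y) = 1 := by
      rw [← hxy, hexp]
      simp only [det₂, Prod.smul_fst, Prod.smul_snd, smul_eq_mul]
      field_simp
    rw [eq_add_smul_of_det₂ hd hxy', sesq_add_left, sesq_add_right, hTx', sesq_smul_left,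
      sesq_smul_left, sesq_smul_right, hxx', hexp, sesq_smul_left, sesq_smul_right, hB,
      map_inv₀] at hx'
    have h1 : ρ * sesq σ l x y * (σ a * a⁻¹ - (σ a)⁻¹ * a) = 0 := by linear_combination hx'
    have h2 := (mul_eq_zero.1 h1).resolve_left (mul_ne_zero hρ0 hA)
    field_simp at h2
    linear_combination h2
  · exfalso
    have hσb : σ b ≠ 0 := (map_ne_zero σ).2 hb0
    have hd : det₂ x' ((-b⁻¹) • x) = 1 := by
      have : det₂ x' ((-b⁻¹) • x) = b⁻¹ * det₂ x x' := by
        simp only [det₂, Prod.smul_fst, Prod.smul_snd, smul_eq_mul]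
        ring
      rw [this, ← hb, inv_mul_cancel₀ hb0]
    have e1 : sesq σ l x' x = σ b * sesq σ l y x := by
      rw [hexp, sesq_add_left, sesq_smul_left, sesq_smul_left, hxx, mul_zero, zero_add]
    have e2 : sesq σ l x x' = b * sesq σ l x y := by
      rw [hexp, sesq_add_right, sesq_smul_right, sesq_smul_right, hxx, mul_zero, zero_add]
    rw [eq_add_smul_of_det₂ hd hxy', sesq_add_left, sesq_add_right, hTx', sesq_smul_left,
      sesq_smul_left, sesq_smul_right, hxx', e1, e2, hB, map_neg, map_inv₀] at hx'
    have h1 : sesq σ l x y * (ρ ^ 2 * (σ b * b⁻¹) - (σ b)⁻¹ * b) = 0 := by linear_combination hx'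
    have h2 := (mul_eq_zero.1 h1).resolve_left hA
    field_simp at h2
    have h3 : (ρ * σ b) ^ 2 = b ^ 2 := by linear_combination h2
    have h4 : ρ * σ ρ * (b * σ b) = b * σ b := by
      rcases sq_eq_sq_iff_eq_or_eq_neg.1 h3 with e | e
      · have e' := congrArg σ e
        rw [map_mul, h.sigma_sigma] at e'
        linear_combination σ ρ * b * e + b * e'
      · have e' := congrArg σ e
        rw [map_mul, h.sigma_sigma, map_neg] at e'
        linear_combination σ ρ * b * e - b * e'
    exact hρ (mul_right_cancel₀ (mul_ne_zero hb0 hσb) (h4.trans (one_mul _).symm))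

theorem card_elliptic_isotropic (h : IsFrobInvolution q σ ξ) {ρ : F} (hρ : ρ * σ ρ ≠ 1)
    (hρ0 : ρ ≠ 0) {l : Fin 4 → F} (hl : ∀ c, c ≠ 0 → pencil σ l c ≠ 0) :
    #{x : F × F | sesq σ l x x = 0 ∧ ∃ y, det₂ x y = 1 ∧
      ρ * sesq σ l x y + sesq σ l y x = 0} = 0 ∨
    #{x : F × F | sesq σ l x x = 0 ∧ ∃ y, det₂ x y = 1 ∧
      ρ * sesq σ l x y + sesq σ l y x = 0} = 2 * (q - 1) ∧ isotropicCard σ l ≠ 0 := by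
  set X := ({x : F × F | sesq σ l x x = 0 ∧ ∃ y, det₂ x y = 1 ∧
      ρ * sesq σ l x y + sesq σ l y x = 0} : Finset (F × F)) with hX
  rcases X.eq_empty_or_nonempty with h0 | ⟨x, hxX⟩
  · left
    rw [h0, card_empty]
  right
  rw [hX, mem_filter_univ] at hxX
  obtain ⟨hxx, y, hxy, hx⟩ := hxX
  have hA : sesq σ l x y ≠ 0 := by
    intro hA
    obtain ⟨c, hc, hc'⟩ := h.exists_pencil_eq_zero_of_gram l hxy hxx hA (by simpa [hA] using hx)
    exact hl c hc hc'
  have hx0 : x ≠ 0 := by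
    rintro rfl
    simp [det₂] at hxy
  constructor
  · have hd : q ^ 2 - 1 = ((q + 1) / 2) * (2 * (q - 1)) := by
      rw [h.sq_sub_one, mul_left_comm, ← mul_assoc, h.half_mul]
    rw [← h.card_pow_eq hd one_ne_zero, one_pow]
    symm
    apply card_nbij (fun a => a • x)
    · intro a ha
      simp only [coe_filter, mem_univ, true_and, Set.mem_ofPred_eq, hX] at ha ⊢
      have ha0 : a ≠ 0 := by
        rintro rfl
        rw [zero_pow (by have := h.one_lt; omega)] at ha
        exact zero_ne_one ha
      have hσa : σ a ≠ 0 := (map_ne_zero σ).2 ha0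
      refine ⟨by rw [sesq_smul_left, sesq_smul_right, hxx]; ring, a⁻¹ • y, ?_, ?_⟩
      · rw [← hxy]
        simp only [det₂, Prod.smul_fst, Prod.smul_snd, smul_eq_mul]
        field_simp
      · rw [h.pow_two_mul_sub_one_eq_one_iff ha0] at ha
        simp only [sesq_smul_left, sesq_smul_right, map_inv₀]
        field_simp
        linear_combination a ^ 2 * hx + ρ * sesq σ l x y * ha
    · intro a _ b _ hab
      exact smul_left_injective F hx0 hab
    · intro x' hx'
      simp only [coe_filter, mem_univ, true_and, Set.mem_ofPred_eq, hX] at hx'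
      obtain ⟨hxx', y', hxy', hx'⟩ := hx'
      obtain ⟨a, ha, rfl⟩ := h.exists_smul_of_elliptic hρ hρ0 l hxy hxx hx hA hxy' hxx' hx'
      exact ⟨a, by simpa using ha, rfl⟩
  · exact (card_pos.2 ⟨x, by simp [hx0, hxx]⟩).ne'

/-- The total point count of a plane section not fixed by the Hermitian involution. -/
theorem count_of_pencil_ne_zero (h : IsFrobInvolution q σ ξ) {ρ : F} (hρ : ρ * σ ρ ≠ 1)
    (hρ0 : ρ ≠ 0) {l : Fin 4 → F} (hl : ∀ c, c ≠ 0 → pencil σ l c ≠ 0) {c₀ c₁ e : ℕ}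
    (h₀ : isotropicCard σ l = (q ^ 2 - 1) * c₀)
    (h₁ : #{z : (F × F) × (F × F) | det₂ z.1 z.2 ≠ 0 ∧
      ξ ^ ((q + 1) / 2) * sesq σ l z.1 z.1 + sesq σ l z.2 z.2 = 0} =
        2 * (q - 1) * (q + 1) ^ 2 * c₁)
    (h₂ : #{z : (F × F) × (F × F) | det₂ z.1 z.2 = 1 ∧
      ρ * sesq σ l z.1 z.2 + sesq σ l z.2 z.1 = 0} = 2 * (q - 1) * e) :
    c₀ + c₁ + e = q ^ 3 + 1 ∨ c₀ + c₁ + e = q ^ 3 + q ^ 2 + 1 := by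
  have hyp := h.card_hyperbolic l
  have ell := h.card_elliptic hρ l
  have hne := h.card_sesq_ne_zero l
  have hS := h.sum_card_sesq_mul h₀ hl
  have hJ := h.card_degenerate_pairs h₀ hl
  have hX := h.card_elliptic_isotropic hρ hρ0 hl
  rw [h₁] at hyp
  rw [h₂] at ell
  rw [h₀] at hyp hne hX
  generalize #{x : F × F | sesq σ l x x = 0 ∧ ∃ y, det₂ x y = 1 ∧
      ρ * sesq σ l x y + sesq σ l y x = 0} = X at *
  generalize #{c : F | c ≠ 0 ∧ (quad (pencil σ l c) = 0 ∧
      quad (pencil σ l (-(ξ ^ ((q + 1) / 2) * c))) = 0)} = J at *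
  generalize (∑ c ∈ ({c : F | c ≠ 0} : Finset F), #{x : F × F | sesq σ l x x = c} *
      #{x : F × F | sesq σ l x x = -(ξ ^ ((q + 1) / 2) * c)}) = S at *
  generalize #{x : F × F | sesq σ l x x ≠ 0} = N at *
  have hq := h.one_lt
  have hq1 : (1 : ℤ) < q := by exact_mod_cast hq
  have key : ∀ j x : ℕ, J = j * (q - 1) → X = x * (q - 1) →
      (2 * (c₀ + c₁ + e) : ℤ) = 2 * (q ^ 3 + 1) + q ^ 2 * (j + x) := by
    intro j x hj hx
    subst hj hx
    rw [h.sq_sub_one] at *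
    zify [hq.le] at hyp ell hne hS
    rw [hS] at hyp
    apply mul_left_cancel₀ (show ((q : ℤ) - 1) * (q + 1) ^ 2 ≠ 0 from
      mul_ne_zero (by omega) (by positivity))
    linear_combination hyp + (q + 1) ^ 2 * (ell + hne)
  rcases hJ with rfl | ⟨rfl, hc₀⟩ <;> rcases hX with rfl | ⟨rfl, hX⟩
  · left
    have := key 0 0 (by simp) (by simp)
    zify
    push_cast at this
    linarith
  · right
    have := key 0 2 (by simp) rfl
    zify
    push_cast at this
    linarith
  · right
    have := key 2 0 rfl (by simp)
    zify
    push_cast at this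
    linarith
  · exact absurd (by rw [hc₀, mul_zero]) hX

theorem sigma_sesq_of_pencil_eq_zero (h : IsFrobInvolution q σ ξ) {l : Fin 4 → F} {c : F}
    (hl : pencil σ l c = 0) (x y : F × F) : σ c * sesq σ l x y = c * σ (sesq σ l y x) := by
  have h1 := h.sesq_pencil l c x y
  rw [hl] at h1
  simp only [sesq, zero_dotProduct] at h1 ⊢
  linear_combination -h1

theorem sum_card_sesq_mul_of_pencil_eq_zero (h : IsFrobInvolution q σ ξ) {l : Fin 4 → F} {c : F}
    (hc : c ≠ 0) (hl : pencil σ l c = 0) :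
    ∑ d ∈ ({d : F | d ≠ 0} : Finset F), #{x : F × F | sesq σ l x x = d} *
      #{x : F × F | sesq σ l x x = -(ξ ^ ((q + 1) / 2) * d)} = 0 := by
  refine sum_eq_zero fun d hd => ?_
  rw [mem_filter_univ] at hd
  by_contra hne
  obtain ⟨x, hx⟩ := card_ne_zero.1 (left_ne_zero_of_mul hne)
  obtain ⟨y, hy⟩ := card_ne_zero.1 (right_ne_zero_of_mul hne)
  rw [mem_filter_univ] at hx hy
  have h1 := h.sigma_sesq_of_pencil_eq_zero hl x x
  have h2 := h.sigma_sesq_of_pencil_eq_zero hl y y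
  rw [hx] at h1
  rw [hy, map_neg, map_mul, h.sigma_omega] at h2
  have h3 : 2 * (ξ ^ ((q + 1) / 2) * (σ c * d)) = 0 := by
    linear_combination ξ ^ ((q + 1) / 2) * h1 - h2
  exact mul_ne_zero h.two_ne_zero (mul_ne_zero h.omega_ne_zero
    (mul_ne_zero ((map_ne_zero σ).2 hc) hd)) h3

theorem isotropicCard_of_pencil_eq_zero (h : IsFrobInvolution q σ ξ) {l : Fin 4 → F} {c : F}
    (hl0 : l ≠ 0) (hc : c ≠ 0) (hl : pencil σ l c = 0) :
    isotropicCard σ l + 1 + (if quad l = 0 then 0 else q) =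
      if quad l = 0 then q ^ 2 else q ^ 3 + q ^ 2 := by
  have hc' : σ c ≠ 0 := (map_ne_zero σ).2 hc
  have e0 := congrFun hl 0
  have e1 := congrFun hl 1
  have e2 := congrFun hl 2
  have e3 := congrFun hl 3
  simp [pencil] at e0 e1 e2 e3
  have h0 : σ (l 0 / c) = l 0 / c := by
    rw [map_div₀]; field_simp; linear_combination -e0
  have h1 : σ (l 1 / c) = l 2 / c := by
    rw [map_div₀]; field_simp; linear_combination -e2
  have h3 : σ (l 3 / c) = l 3 / c := by
    rw [map_div₀]; field_simp; linear_combination -e3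
  have hiff : l 0 / c * (l 3 / c) = l 1 / c * σ (l 1 / c) ↔ quad l = 0 := by
    rw [h1, quad, sub_eq_zero]
    field_simp
  have key := h.card_hermitian (β := l 1 / c) h0 h3 (by
    rintro ⟨f0, f1, f3⟩
    rw [f1, map_zero] at h1
    apply hl0
    funext i
    fin_cases i
    · exact (div_eq_zero_iff.1 f0).resolve_right hc
    · exact (div_eq_zero_iff.1 f1).resolve_right hc
    · exact (div_eq_zero_iff.1 h1.symm).resolve_right hc
    · exact (div_eq_zero_iff.1 f3).resolve_right hc)
  simp only [hiff] at key
  rw [← key, ← card_sesq_eq_zero]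
  congr 2
  ext x
  rw [mem_filter_univ, mem_filter_univ, ← mul_eq_zero_iff_left (b := sesq σ l x x)
    (inv_ne_zero hc), sesq_eq, h1]
  constructor <;> intro H <;> linear_combination H

theorem card_elliptic_isotropic_of_pencil_eq_zero (h : IsFrobInvolution q σ ξ) {ρ : F}
    (hρ : ρ * σ ρ ≠ 1) {l : Fin 4 → F} {c : F} (hc : c ≠ 0) (hl : pencil σ l c = 0) :
    #{x : F × F | sesq σ l x x = 0 ∧ ∃ y, det₂ x y = 1 ∧
      ρ * sesq σ l x y + sesq σ l y x = 0} = if quad l = 0 then isotropicCard σ l else 0 := by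
  have hc' : σ c ≠ 0 := (map_ne_zero σ).2 hc
  have hnorm : ∀ x y, sesq σ l y x * σ (sesq σ l y x) = sesq σ l x y * σ (sesq σ l x y) := by
    intro x y
    have h1 := h.sigma_sesq_of_pencil_eq_zero hl y x
    have h2 := h.sigma_sesq_of_pencil_eq_zero hl x y
    apply mul_left_cancel₀ (mul_ne_zero hc hc')
    linear_combination c * σ (sesq σ l y x) * h1 - c * σ (sesq σ l x y) * h2
  have hdet : ∀ x y, det₂ x y = 1 → sesq σ l x x = 0 →
      -(sesq σ l x y * sesq σ l y x) = quad l := by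
    intro x y hxy hxx
    have h1 := sesq_det (σ := σ) l x y
    rw [hxy, hxx, map_one] at h1
    rw [quad]
    linear_combination h1
  split_ifs with hquad
  · rw [isotropicCard]
    congr 1
    ext x
    simp only [mem_filter_univ]
    constructor
    · rintro ⟨hxx, y, hxy, -⟩
      refine ⟨?_, hxx⟩
      rintro rfl
      simp [det₂] at hxy
    · rintro ⟨hx0, hxx⟩
      obtain ⟨y, hxy⟩ := exists_det₂_eq_one hx0
      refine ⟨hxx, y, hxy, ?_⟩
      have h1 := hdet x y hxy hxx
      rw [hquad, neg_eq_zero, mul_eq_zero] at h1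
      have h2 := hnorm x y
      rcases h1 with h1 | h1
      · rw [h1] at h2 ⊢
        simpa using h2
      · rw [h1] at h2 ⊢
        have : sesq σ l x y = 0 := by simpa using h2.symm
        rw [this]
        ring
  · rw [card_eq_zero, filter_eq_empty_iff]
    rintro x - ⟨hxx, y, hxy, hx⟩
    have h1 := hdet x y hxy hxx
    have hA : sesq σ l x y ≠ 0 := by
      intro hA
      rw [hA, zero_mul, neg_zero] at h1
      exact hquad h1.symm
    have h2 := hnorm x y
    rw [show sesq σ l y x = -(ρ * sesq σ l x y) by linear_combination hx, map_neg, map_mul] at h2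
    apply hρ
    apply mul_right_cancel₀ (mul_ne_zero hA ((map_ne_zero σ).2 hA))
    linear_combination h2

/-- The total point count of a plane section fixed by the Hermitian involution. -/
theorem count_of_pencil_eq_zero (h : IsFrobInvolution q σ ξ) {ρ : F} (hρ : ρ * σ ρ ≠ 1)
    {l : Fin 4 → F} {c : F} (hl0 : l ≠ 0) (hc : c ≠ 0) (hl : pencil σ l c = 0) {c₀ c₁ e : ℕ}
    (h₀ : isotropicCard σ l = (q ^ 2 - 1) * c₀)
    (h₁ : #{z : (F × F) × (F × F) | det₂ z.1 z.2 ≠ 0 ∧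
      ξ ^ ((q + 1) / 2) * sesq σ l z.1 z.1 + sesq σ l z.2 z.2 = 0} =
        2 * (q - 1) * (q + 1) ^ 2 * c₁)
    (h₂ : #{z : (F × F) × (F × F) | det₂ z.1 z.2 = 1 ∧
      ρ * sesq σ l z.1 z.2 + sesq σ l z.2 z.1 = 0} = 2 * (q - 1) * e) :
    c₀ + c₁ + e = q ^ 3 + 1 ∨ c₀ + c₁ + e = q ^ 3 + q ^ 2 + 1 := by
  have hyp := h.card_hyperbolic l
  have ell := h.card_elliptic hρ l
  have hne := h.card_sesq_ne_zero l
  have hz := h.isotropicCard_of_pencil_eq_zero hl0 hc hl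
  rw [h.sum_card_sesq_mul_of_pencil_eq_zero hc hl, h₁] at hyp
  rw [h.card_elliptic_isotropic_of_pencil_eq_zero hρ hc hl, h₂] at ell
  have hq := h.one_lt
  have hq1 : (1 : ℤ) < q := by exact_mod_cast hq
  have hp1 : (q : ℤ) - 1 ≠ 0 := by omega
  have hp2 : (q : ℤ) + 1 ≠ 0 := by omega
  rw [h.sq_sub_one] at h₀
  split_ifs at hz ell with hquad
  · right
    rw [h₀] at hyp ell hne hz
    zify [hq.le] at hyp ell hne hz ⊢
    have hc₀ : (c₀ : ℤ) = 1 := by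
      apply mul_left_cancel₀ (mul_ne_zero hp2 hp1)
      linear_combination hz
    rw [hc₀] at hyp ell hne ⊢
    have hc₁ : (c₁ : ℤ) = 0 := by
      apply mul_left_cancel₀ (mul_ne_zero (mul_ne_zero _root_.two_ne_zero hp1) (pow_ne_zero 2 hp2))
      linear_combination hyp
    have he : (e : ℤ) = q ^ 2 * (q + 1) := by
      apply mul_left_cancel₀ (mul_ne_zero _root_.two_ne_zero hp1)
      linear_combination ell + hne
    rw [hc₁, he]
    ring
  · left
    rw [h₀] at hyp hne hz
    zify [hq.le] at hyp ell hne hz ⊢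
    have hc₀ : (c₀ : ℤ) = q + 1 := by
      apply mul_left_cancel₀ (mul_ne_zero hp2 hp1)
      linear_combination hz
    rw [hc₀] at hyp hne ⊢
    have hc₁ : 2 * (c₁ : ℤ) = (q - 1) * (q + 1) * q := by
      apply mul_left_cancel₀ (mul_ne_zero hp1 (pow_ne_zero 2 hp2))
      linear_combination hyp
    have he : 2 * (e : ℤ) = q * (q ^ 2 - 1) := by
      apply mul_left_cancel₀ hp1
      linear_combination ell + hne
    linarith

theorem count_zero (h : IsFrobInvolution q σ ξ) {ρ : F} (hρ : ρ * σ ρ ≠ 1) {c₀ c₁ e : ℕ}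
    (h₀ : isotropicCard σ (0 : Fin 4 → F) = (q ^ 2 - 1) * c₀)
    (h₁ : #{z : (F × F) × (F × F) | det₂ z.1 z.2 ≠ 0 ∧
      ξ ^ ((q + 1) / 2) * sesq σ 0 z.1 z.1 + sesq σ 0 z.2 z.2 = 0} =
        2 * (q - 1) * (q + 1) ^ 2 * c₁)
    (h₂ : #{z : (F × F) × (F × F) | det₂ z.1 z.2 = 1 ∧
      ρ * sesq σ 0 z.1 z.2 + sesq σ 0 z.2 z.1 = 0} = 2 * (q - 1) * e) :
    c₀ + c₁ + e = (q ^ 2 + 1) * (q ^ 3 + 1) := by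
  have hyp := h.card_hyperbolic 0
  have ell := h.card_elliptic hρ 0
  have hne := h.card_sesq_ne_zero 0
  have hl : pencil σ (0 : Fin 4 → F) 1 = 0 := by
    funext i
    fin_cases i <;> simp [pencil]
  rw [h.sum_card_sesq_mul_of_pencil_eq_zero one_ne_zero hl, h₁] at hyp
  rw [h.card_elliptic_isotropic_of_pencil_eq_zero hρ one_ne_zero hl, h₂,
    if_pos (by simp [quad])] at ell
  have h0 : #{x : F × F | sesq σ 0 x x ≠ 0} = 0 := by simp [sesq]
  have hq := h.one_lt
  have hq1 : (1 : ℤ) < q := by exact_mod_cast hq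
  have hp1 : (q : ℤ) - 1 ≠ 0 := by omega
  have hp2 : (q : ℤ) + 1 ≠ 0 := by omega
  rw [h₀, h.sq_sub_one] at hyp ell hne
  rw [h0] at ell hne
  zify [hq.le] at hyp ell hne ⊢
  have hc₀ : (c₀ : ℤ) = q ^ 2 + 1 := by
    apply mul_left_cancel₀ (mul_ne_zero hp2 hp1)
    linear_combination hne
  rw [hc₀] at hyp ell ⊢
  have hc₁ : 2 * (c₁ : ℤ) = (q ^ 2 + 1) * q ^ 2 * (q - 1) := by
    apply mul_left_cancel₀ (mul_ne_zero hp1 (pow_ne_zero 2 hp2))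
    linear_combination hyp
  have he : 2 * (e : ℤ) = q ^ 2 * (q + 1) * (q ^ 2 + 1) := by
    apply mul_left_cancel₀ hp1
    linear_combination ell
  linarith

/-- The total point count of an arbitrary plane section. -/
theorem count_of_ne_zero (h : IsFrobInvolution q σ ξ) {ρ : F} (hρ : ρ * σ ρ ≠ 1)
    (hρ0 : ρ ≠ 0) {l : Fin 4 → F} (hl : l ≠ 0) {c₀ c₁ e : ℕ}
    (h₀ : isotropicCard σ l = (q ^ 2 - 1) * c₀)
    (h₁ : #{z : (F × F) × (F × F) | det₂ z.1 z.2 ≠ 0 ∧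
      ξ ^ ((q + 1) / 2) * sesq σ l z.1 z.1 + sesq σ l z.2 z.2 = 0} =
        2 * (q - 1) * (q + 1) ^ 2 * c₁)
    (h₂ : #{z : (F × F) × (F × F) | det₂ z.1 z.2 = 1 ∧
      ρ * sesq σ l z.1 z.2 + sesq σ l z.2 z.1 = 0} = 2 * (q - 1) * e) :
    c₀ + c₁ + e = q ^ 3 + 1 ∨ c₀ + c₁ + e = q ^ 3 + q ^ 2 + 1 := by
  by_cases H : ∃ c, c ≠ 0 ∧ pencil σ l c = 0
  · obtain ⟨c, hc, hcl⟩ := H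
    exact h.count_of_pencil_eq_zero hρ hl hc hcl h₀ h₁ h₂
  · push Not at H
    exact h.count_of_pencil_ne_zero hρ hρ0 H h₀ h₁ h₂

end IsFrobInvolution

/-- Double counting of the points of a plane section along a parametrization. -/
theorem card_eq_mul_ncard {α : Type*} {A : Finset α} {g : α → Fin 4 → F}
    (hg : ∀ a ∈ A, g a ≠ 0) {m : ℕ}
    (hm : ∀ a ∈ A, #{b ∈ A | ∃ t : F, t ≠ 0 ∧ g b = t • g a} = m) (l : Fin 4 → F) :
    #{a ∈ A | l ⬝ᵥ g a = 0} = m * (pointsOf A g ∩ {P | l ⬝ᵥ P.rep = 0}).ncard := by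
  have hrep : ∀ v (hv : v ≠ 0), l ⬝ᵥ (Projectivization.mk F v hv).rep = 0 ↔ l ⬝ᵥ v = 0 :=
    mk_mem_iff (fun v => l ⬝ᵥ v = 0) fun t v ht => by simp [dotProduct_smul, ht]
  set B := ({a ∈ A | l ⬝ᵥ g a = 0} : Finset α) with hB
  have hBA : ∀ b : B, b.1 ∈ A ∧ l ⬝ᵥ g b.1 = 0 := fun b => mem_filter.1 b.2
  let f : B → PGPoint F := fun b => Projectivization.mk F (g b.1) (hg b.1 (hBA b).1)
  have hS : pointsOf A g ∩ {P | l ⬝ᵥ P.rep = 0} = ((univ.image f : Finset (PGPoint F)) : Set (PGPoint F)) := by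
    ext P
    simp only [pointsOf, Set.mem_inter_iff, Set.mem_ofPred_eq, coe_image, coe_univ, Set.image_univ,
      Set.mem_range]
    constructor
    · rintro ⟨⟨a, ha, h, rfl⟩, hP⟩
      rw [hrep] at hP
      exact ⟨⟨a, by rw [hB, mem_filter]; exact ⟨ha, hP⟩⟩, rfl⟩
    · rintro ⟨b, rfl⟩
      exact ⟨⟨b.1, (hBA b).1, hg b.1 (hBA b).1, rfl⟩, (hrep _ _).2 (hBA b).2⟩
  rw [hS, Set.ncard_coe_finset]
  have h1 : #(univ : Finset B) = #B := by simp
  rw [← h1, card_eq_sum_card_image f, sum_congr rfl (g := fun _ => m), sum_const, smul_eq_mul,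
    mul_comm]
  intro P hP
  obtain ⟨a, -, rfl⟩ := mem_image.1 hP
  rw [← hm a.1 (hBA a).1]
  apply card_nbij (fun b => b.1)
  · intro b hb
    simp only [coe_filter, mem_univ, true_and, Set.mem_ofPred_eq] at hb ⊢
    obtain ⟨t, ht⟩ := (Projectivization.mk_eq_mk_iff' F _ _ _ _).1 hb
    refine ⟨(hBA b).1, t, ?_, ht.symm⟩
    rintro rfl
    exact hg b.1 (hBA b).1 (by rw [← ht, zero_smul])
  · exact Subtype.val_injective.injOn
  · intro b hb
    simp only [coe_filter, Set.mem_ofPred_eq] at hb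
    obtain ⟨hbA, t, ht, hbt⟩ := hb
    refine ⟨⟨b, ?_⟩, ?_, rfl⟩
    · rw [hB, mem_filter]
      refine ⟨hbA, ?_⟩
      rw [hbt, dotProduct_smul, (hBA a).2, smul_zero]
    · simp only [coe_filter, mem_univ, true_and, Set.mem_ofPred_eq]
      exact (Projectivization.mk_eq_mk_iff' F _ _ _ _).2 ⟨t, hbt.symm⟩

namespace IsFrobInvolution

theorem card_fiber_isotropic (h : IsFrobInvolution q σ ξ) {x : F × F} (hx : x ≠ 0) :
    #{y ∈ ({y : F × F | y ≠ 0} : Finset (F × F)) |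
      ∃ t : F, t ≠ 0 ∧ herProd σ y y = t • herProd σ x x} = q ^ 2 - 1 := by
  have h1 : #({a : F | a ≠ 0} : Finset F) = q ^ 2 - 1 := by
    rw [filter_ne', card_erase_of_mem (mem_univ _), card_univ, h.card]
  rw [← h1]
  symm
  apply card_nbij (fun a => a • x)
  · intro a ha
    simp only [coe_filter, mem_univ, true_and, mem_filter, Set.mem_ofPred_eq] at ha ⊢
    refine ⟨smul_ne_zero ha hx, a * σ a, mul_ne_zero ha ((map_ne_zero σ).2 ha), ?_⟩
    rw [herProd_smul_left, herProd_smul_right, smul_smul, mul_comm]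
  · intro a _ b _ hab
    exact smul_left_injective F hx hab
  · intro y hy
    simp only [coe_filter, mem_univ, true_and, mem_filter, Set.mem_ofPred_eq] at hy
    obtain ⟨hy0, t, -, hyt⟩ := hy
    obtain ⟨z, hz⟩ := exists_det₂_eq_one hx
    have hz' : det₂ x z ≠ 0 := by rw [hz]; exact one_ne_zero
    obtain ⟨a, b, rfl⟩ := exists_eq_smul_add_smul hz' y
    have h2 := eq_zero_of_herProd_comb (σ := σ) (a := a * σ a - t) (b := σ a * b) (c := a * σ b)
      (d := b * σ b) hz' (by
        rw [herProd_smul_add_smul, ← sub_eq_zero] at hyt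
        rw [← hyt]
        module)
    have hb : b = 0 := by simpa using h2.2.2.2
    subst hb
    refine ⟨a, ?_, by simp⟩
    simp only [coe_filter, mem_univ, true_and, Set.mem_ofPred_eq]
    rintro rfl
    simp at hy0

theorem card_norm_pairs (h : IsFrobInvolution q σ ξ) {r : F} (hr0 : r ≠ 0) (hr : σ r = r) :
    #{z : F × F | z.1 ≠ 0 ∧ z.2 * σ z.2 = r * (z.1 * σ z.1)} = (q ^ 2 - 1) * (q + 1) := by
  rw [card_filter_prod, h.sum_eq_of_ne_zero (B := q + 1)]
  · simp
  · intro b hb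
    simp only [hb, ne_eq, not_false_eq_true, true_and]
    apply h.card_norm (mul_ne_zero hr0 (mul_ne_zero hb ((map_ne_zero σ).2 hb)))
    simp only [map_mul, hr, h.sigma_sigma]
    ring

theorem hyperbolic_fiber_cases (h : IsFrobInvolution q σ ξ) {x y : F × F} (hxy : det₂ x y ≠ 0)
    {a b c d t : F}
    (ht : ξ ^ ((q + 1) / 2) • herProd σ (a • x + b • y) (a • x + b • y) +
      herProd σ (c • x + d • y) (c • x + d • y) =
        t • (ξ ^ ((q + 1) / 2) • herProd σ x x + herProd σ y y)) :
    (b = 0 ∧ c = 0 ∧ d * σ d = a * σ a) ∨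
      (a = 0 ∧ d = 0 ∧ c * σ c = (ξ ^ ((q + 1) / 2)) ^ 2 * (b * σ b)) := by
  have ho := h.omega_ne_zero
  have hs := h.sigma_omega
  set ω := ξ ^ ((q + 1) / 2)
  obtain ⟨e1, e2, e3, e4⟩ := eq_zero_of_herProd_comb (σ := σ)
    (a := ω * (a * σ a) + c * σ c - t * ω) (b := ω * (σ a * b) + σ c * d)
    (c := ω * (σ b * a) + σ d * c) (d := ω * (b * σ b) + d * σ d - t) hxy (by
      rw [herProd_smul_add_smul, herProd_smul_add_smul, ← sub_eq_zero] at ht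
      rw [← ht]
      module)
  have e5 : ω * (a * σ a - d * σ d) = ω ^ 2 * (b * σ b) - c * σ c := by
    linear_combination e1 - ω * e4
  have e6 := congrArg σ e5
  simp only [map_mul, map_sub, map_pow, hs, h.sigma_sigma] at e6
  have e7 : c * σ c = ω ^ 2 * (b * σ b) := by
    apply mul_left_cancel₀ h.two_ne_zero
    linear_combination e5 + e6
  have e8 : d * σ d = a * σ a := by
    apply mul_left_cancel₀ ho
    linear_combination -e5 + e7
  have e9 := congrArg σ e2
  simp only [map_mul, map_add, map_zero, hs, h.sigma_sigma] at e9
  have e10 : a * σ b = 0 := by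
    apply mul_left_cancel₀ (mul_ne_zero h.two_ne_zero ho)
    linear_combination e3 - e9
  have hσ : ∀ z : F, z * σ z = 0 → z = 0 := fun z hz => by
    rcases mul_eq_zero.1 hz with hz | hz
    · exact hz
    · exact (map_eq_zero σ).1 hz
  rcases mul_eq_zero.1 e10 with ha | hb
  · rw [ha, zero_mul] at e8
    exact Or.inr ⟨ha, hσ d e8, e7⟩
  · have hb := (map_eq_zero σ).1 hb
    rw [hb, zero_mul, mul_zero] at e7
    exact Or.inl ⟨hb, hσ c e7, e8⟩

theorem card_fiber_hyperbolic (h : IsFrobInvolution q σ ξ) {z : (F × F) × (F × F)}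
    (hz : det₂ z.1 z.2 ≠ 0) :
    #{w ∈ ({w : (F × F) × (F × F) | det₂ w.1 w.2 ≠ 0} : Finset _) | ∃ t : F, t ≠ 0 ∧
      ξ ^ ((q + 1) / 2) • herProd σ w.1 w.1 + herProd σ w.2 w.2 =
        t • (ξ ^ ((q + 1) / 2) • herProd σ z.1 z.1 + herProd σ z.2 z.2)} =
      2 * (q - 1) * (q + 1) ^ 2 := by
  obtain ⟨x, y⟩ := z
  replace hz : det₂ x y ≠ 0 := hz
  have hx : x ≠ 0 := by rintro rfl; simp [det₂] at hz
  have hy : y ≠ 0 := by rintro rfl; simp [det₂] at hz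
  have key := fun a b c d t => h.hyperbolic_fiber_cases hz (a := a) (b := b) (c := c) (d := d)
    (t := t)
  have ho := h.omega_ne_zero
  have hs := h.sigma_omega
  set ω := ξ ^ ((q + 1) / 2) with hω
  have c1 := h.card_norm_pairs one_ne_zero (map_one σ)
  have c2 := h.card_norm_pairs (pow_ne_zero 2 ho) (by rw [map_pow, hs, neg_sq])
  have hσ : ∀ {s : F}, s ≠ 0 → σ s ≠ 0 := fun hs => (map_ne_zero σ).2 hs
  have hset : ({w ∈ ({w : (F × F) × (F × F) | det₂ w.1 w.2 ≠ 0} : Finset _) | ∃ t : F, t ≠ 0 ∧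
      ω • herProd σ w.1 w.1 + herProd σ w.2 w.2 =
        t • (ω • herProd σ x x + herProd σ y y)} : Finset _) =
      ({p : F × F | p.1 ≠ 0 ∧ p.2 * σ p.2 = 1 * (p.1 * σ p.1)} : Finset _).image
        (fun p => (p.1 • x, p.2 • y)) ∪
      ({p : F × F | p.1 ≠ 0 ∧ p.2 * σ p.2 = ω ^ 2 * (p.1 * σ p.1)} : Finset _).image
        (fun p => (p.1 • y, p.2 • x)) := by
    ext ⟨x', y'⟩
    simp only [mem_filter, mem_univ, true_and, mem_union, mem_image, Prod.mk.injEq, Prod.exists]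
    constructor
    · rintro ⟨hdet, t, ht, H⟩
      obtain ⟨a, b, rfl⟩ := exists_eq_smul_add_smul hz x'
      obtain ⟨c, d, rfl⟩ := exists_eq_smul_add_smul hz y'
      rw [det₂_smul_add_smul] at hdet
      rcases key a b c d t H with ⟨rfl, rfl, H'⟩ | ⟨rfl, rfl, H'⟩
      · refine Or.inl ⟨a, d, ⟨?_, by rw [one_mul, H']⟩, by simp, by simp⟩
        rintro rfl
        simp at hdet
      · refine Or.inr ⟨b, c, ⟨?_, H'⟩, by simp, by simp⟩
        rintro rfl
        simp at hdet
    · rintro (⟨a, d, ⟨ha, H⟩, rfl, rfl⟩ | ⟨b, c, ⟨hb, H⟩, rfl, rfl⟩)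
      · rw [one_mul] at H
        have hd : d ≠ 0 := by
          rintro rfl
          rw [zero_mul] at H
          exact mul_ne_zero ha (hσ ha) H.symm
        refine ⟨?_, a * σ a, mul_ne_zero ha (hσ ha), ?_⟩
        · rw [det₂_smul_smul]
          exact mul_ne_zero (mul_ne_zero ha hd) hz
        · simp only [herProd_smul_left, herProd_smul_right, smul_smul, smul_add]
          rw [H, mul_comm ω]
      · have hc : c ≠ 0 := by
          rintro rfl
          rw [zero_mul] at H
          exact mul_ne_zero (pow_ne_zero 2 ho) (mul_ne_zero hb (hσ hb)) H.symm
        refine ⟨?_, ω * (b * σ b), mul_ne_zero ho (mul_ne_zero hb (hσ hb)), ?_⟩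
        · rw [det₂_smul_smul, det₂_comm]
          exact mul_ne_zero (mul_ne_zero hb hc) (neg_ne_zero.2 hz)
        · simp only [herProd_smul_left, herProd_smul_right, smul_smul, smul_add]
          rw [H, add_comm]
          congr 2
          ring
  rw [hset, card_union_of_disjoint, card_image_of_injective, card_image_of_injective, c1, c2,
    h.sq_sub_one]
  · ring
  · rintro ⟨a, b⟩ ⟨c, d⟩ H
    rw [Prod.mk.injEq] at H ⊢
    exact ⟨smul_left_injective F hy H.1, smul_left_injective F hx H.2⟩
  · rintro ⟨a, b⟩ ⟨c, d⟩ H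
    rw [Prod.mk.injEq] at H ⊢
    exact ⟨smul_left_injective F hx H.1, smul_left_injective F hy H.2⟩
  · rw [disjoint_left]
    intro w h1 h2
    simp only [mem_image, mem_filter, mem_univ, true_and, Prod.exists] at h1 h2
    obtain ⟨a, d, ⟨ha, -⟩, rfl⟩ := h1
    obtain ⟨b, c, -, H⟩ := h2
    rw [Prod.mk.injEq] at H
    have h3 : a * det₂ x y = 0 := by
      have h4 := congrArg (fun u => det₂ u y) H.1
      simp only [det₂, Prod.smul_fst, Prod.smul_snd, smul_eq_mul] at h4 ⊢
      linear_combination -h4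
    exact mul_ne_zero ha hz h3

theorem elliptic_fiber_cases (h : IsFrobInvolution q σ ξ) {ρ : F} (hρ : ρ * σ ρ ≠ 1)
    (hρ0 : ρ ≠ 0) {x y : F × F} (hxy : det₂ x y ≠ 0) {a b c d t : F} (habcd : a * d - b * c = 1)
    (ht : ρ • herProd σ (a • x + b • y) (c • x + d • y) +
      herProd σ (c • x + d • y) (a • x + b • y) =
        t • (ρ • herProd σ x y + herProd σ y x)) :
    b = 0 ∧ c = 0 ∧ d = a⁻¹ ∧ a ^ (2 * (q - 1)) = 1 := by
  obtain ⟨e1, e2, e3, e4⟩ := eq_zero_of_herProd_comb (σ := σ)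
    (a := ρ * (σ a * c) + σ c * a) (b := ρ * (σ a * d) + σ c * b - t * ρ)
    (c := ρ * (σ b * c) + σ d * a - t) (d := ρ * (σ b * d) + σ d * b) hxy (by
      rw [herProd_smul_add_smul, herProd_smul_add_smul, ← sub_eq_zero] at ht
      rw [← ht]
      module)
  have key : ∀ u v : F, ρ * (σ u * v) + σ v * u = 0 → u = 0 ∨ v = 0 := by
    intro u v H
    by_contra! hc
    have H' := congrArg σ H
    simp only [map_mul, map_add, map_zero, h.sigma_sigma] at H'
    apply hρ
    apply mul_right_cancel₀ (mul_ne_zero (mul_ne_zero hc.1 hc.2)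
      ((map_ne_zero σ).2 (mul_ne_zero hc.1 hc.2)))
    rw [map_mul]
    linear_combination σ ρ * (u * σ v) * H - u * σ v * H'
  have hd : b = 0 ∧ c = 0 := by
    rcases key a c e1 with rfl | rfl
    · exfalso
      have hb : b ≠ 0 := by rintro rfl; simp at habcd
      obtain rfl : d = 0 := (key b d e4).resolve_left hb
      have hc : c ≠ 0 := by rintro rfl; simp at habcd
      simp only [map_zero, mul_zero, zero_add, zero_sub, add_zero] at e2 e3 habcd
      have hbc : b * c = -1 := by linear_combination -habcd
      have hσbc : σ b * σ c = -1 := by rw [← map_mul, hbc, map_neg, map_one]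
      have e5 : (ρ * σ b - b) * (ρ * σ b + b) = 0 := by
        linear_combination b * σ b * (e2 - ρ * e3) - b ^ 2 * hσbc + ρ ^ 2 * σ b ^ 2 * hbc
      have e6 : (ρ * σ ρ - 1) * (b * σ b) = 0 := by
        rcases mul_eq_zero.1 e5 with e6 | e6
        · have e7 := congrArg σ e6
          simp only [map_mul, map_sub, map_zero, h.sigma_sigma] at e7
          linear_combination σ ρ * b * e6 + b * e7
        · have e7 := congrArg σ e6
          simp only [map_mul, map_add, map_zero, h.sigma_sigma] at e7
          linear_combination σ ρ * b * e6 - b * e7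
      exact mul_ne_zero (sub_ne_zero.2 hρ) (mul_ne_zero hb ((map_ne_zero σ).2 hb)) e6
    · have ha : a ≠ 0 := by rintro rfl; simp at habcd
      have hd : d ≠ 0 := by rintro rfl; simp at habcd
      exact ⟨(key b d e4).resolve_right hd, rfl⟩
  obtain ⟨rfl, rfl⟩ := hd
  simp only [map_zero, mul_zero, zero_add, add_zero, sub_zero] at e2 e3 habcd
  have ha : a ≠ 0 := by rintro rfl; simp at habcd
  have hσ : σ a * σ d = 1 := by rw [← map_mul, habcd, map_one]
  refine ⟨rfl, rfl, eq_inv_of_mul_eq_one_right habcd, ?_⟩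
  rw [h.pow_two_mul_sub_one_eq_one_iff ha]
  apply mul_left_cancel₀ hρ0
  linear_combination a * σ a * (e2 - ρ * e3) - ρ * σ a ^ 2 * habcd + ρ * a ^ 2 * hσ

theorem card_fiber_elliptic (h : IsFrobInvolution q σ ξ) {ρ : F} (hρ : ρ * σ ρ ≠ 1)
    (hρ0 : ρ ≠ 0) {z : (F × F) × (F × F)} (hz : det₂ z.1 z.2 = 1) :
    #{w ∈ ({w : (F × F) × (F × F) | det₂ w.1 w.2 = 1} : Finset _) | ∃ t : F, t ≠ 0 ∧
      ρ • herProd σ w.1 w.2 + herProd σ w.2 w.1 =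
        t • (ρ • herProd σ z.1 z.2 + herProd σ z.2 z.1)} = 2 * (q - 1) := by
  obtain ⟨x, y⟩ := z
  replace hz : det₂ x y = 1 := hz
  have hz' : det₂ x y ≠ 0 := by rw [hz]; exact one_ne_zero
  have hx : x ≠ 0 := by rintro rfl; simp [det₂] at hz
  have hq := h.one_lt
  have h1 := h.card_pow_eq (d := (q + 1) / 2) (e := 2 * (q - 1))
    (by rw [h.sq_sub_one, mul_left_comm, ← mul_assoc, h.half_mul]) one_ne_zero
  rw [one_pow] at h1
  rw [← h1]
  symm
  apply card_nbij (fun a => (a • x, a⁻¹ • y))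
  · intro a ha
    simp only [coe_filter, mem_univ, true_and, mem_filter, Set.mem_ofPred_eq] at ha ⊢
    have ha0 : a ≠ 0 := by
      rintro rfl
      rw [zero_pow (by omega)] at ha
      exact zero_ne_one ha
    rw [h.pow_two_mul_sub_one_eq_one_iff ha0] at ha
    refine ⟨by rw [det₂_smul_smul, mul_inv_cancel₀ ha0, one_mul, hz], σ a * a⁻¹,
      mul_ne_zero ((map_ne_zero σ).2 ha0) (inv_ne_zero ha0), ?_⟩
    have ha1 : σ a⁻¹ * a = σ a * a⁻¹ := by
      rw [map_inv₀]
      field_simp [(map_ne_zero σ).2 ha0]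
      exact ha.symm
    simp only [herProd_smul_left, herProd_smul_right, smul_add]
    rw [smul_smul a, mul_comm a, ha1]
    module
  · intro a _ b _ hab
    exact smul_left_injective F hx (Prod.ext_iff.1 hab).1
  · rintro ⟨x', y'⟩ hw
    simp only [coe_filter, mem_univ, true_and, mem_filter, Set.mem_ofPred_eq] at hw
    obtain ⟨hdet, t, -, H⟩ := hw
    obtain ⟨a, b, rfl⟩ := exists_eq_smul_add_smul hz' x'
    obtain ⟨c, d, rfl⟩ := exists_eq_smul_add_smul hz' y'
    rw [det₂_smul_add_smul, hz, mul_one] at hdet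
    obtain ⟨rfl, rfl, rfl, ha⟩ := h.elliptic_fiber_cases hρ hρ0 hz' hdet H
    exact ⟨a, by simpa using ha, by simp⟩

end IsFrobInvolution

/-- The points of the Hermitian Veronese curve. -/
def curvePoints (σ : F →+* F) : Set (PGPoint F) :=
  pointsOf ({x : F × F | x ≠ 0} : Finset _) fun x => herProd σ x x

/-- The points obtained from the skew Hermitian tensors of rank two. -/
def hyperbolicPoints (σ : F →+* F) (ω : F) : Set (PGPoint F) :=
  pointsOf ({z : (F × F) × (F × F) | det₂ z.1 z.2 ≠ 0} : Finset _) fun z =>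
    ω • herProd σ z.1 z.1 + herProd σ z.2 z.2

/-- The points obtained from the tensors of elliptic type with parameter `ρ`. -/
def ellipticPoints (σ : F →+* F) (ρ : F) : Set (PGPoint F) :=
  pointsOf ({z : (F × F) × (F × F) | det₂ z.1 z.2 = 1} : Finset _) fun z =>
    ρ • herProd σ z.1 z.2 + herProd σ z.2 z.1

namespace IsFrobInvolution

theorem isotropicCard_eq (h : IsFrobInvolution q σ ξ) (l : Fin 4 → F) :
    isotropicCard σ l = (q ^ 2 - 1) * (curvePoints σ ∩ {P | l ⬝ᵥ P.rep = 0}).ncard := by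
  rw [curvePoints, ← card_eq_mul_ncard]
  · rw [isotropicCard, filter_filter]
    rfl
  · intro x hx
    exact herProd_self_ne_zero (mem_filter.1 hx).2
  · intro x hx
    exact h.card_fiber_isotropic (mem_filter.1 hx).2

theorem card_hyperbolic_eq (h : IsFrobInvolution q σ ξ) (l : Fin 4 → F) :
    #{z : (F × F) × (F × F) | det₂ z.1 z.2 ≠ 0 ∧
      ξ ^ ((q + 1) / 2) * sesq σ l z.1 z.1 + sesq σ l z.2 z.2 = 0} =
    2 * (q - 1) * (q + 1) ^ 2 *
      (hyperbolicPoints σ (ξ ^ ((q + 1) / 2)) ∩ {P | l ⬝ᵥ P.rep = 0}).ncard := by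
  rw [hyperbolicPoints, ← card_eq_mul_ncard]
  · rw [filter_filter]
    simp only [sesq, dotProduct_add, dotProduct_smul, smul_eq_mul]
    congr!
  · intro x hx
    exact hyperbolic_ne_zero _ (mem_filter.1 hx).2
  · intro x hx
    exact h.card_fiber_hyperbolic (mem_filter.1 hx).2

theorem card_elliptic_eq (h : IsFrobInvolution q σ ξ) {ρ : F} (hρ : ρ * σ ρ ≠ 1) (hρ0 : ρ ≠ 0)
    (l : Fin 4 → F) :
    #{z : (F × F) × (F × F) | det₂ z.1 z.2 = 1 ∧
      ρ * sesq σ l z.1 z.2 + sesq σ l z.2 z.1 = 0} =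
    2 * (q - 1) * (ellipticPoints σ ρ ∩ {P | l ⬝ᵥ P.rep = 0}).ncard := by
  rw [ellipticPoints, ← card_eq_mul_ncard]
  · rw [filter_filter]
    simp only [sesq, dotProduct_add, dotProduct_smul, smul_eq_mul]
    congr!
  · intro x hx
    apply elliptic_ne_zero
    rw [(mem_filter.1 hx).2]
    exact one_ne_zero
  · intro x hx
    exact h.card_fiber_elliptic hρ hρ0 (mem_filter.1 hx).2

theorem ncard_union_inter (ρ ω : F) (h01 : Disjoint (curvePoints σ) (hyperbolicPoints σ ω))
    (h02 : Disjoint (curvePoints σ) (ellipticPoints σ ρ))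
    (h12 : Disjoint (hyperbolicPoints σ ω) (ellipticPoints σ ρ)) (S : Set (PGPoint F)) :
    ((curvePoints σ ∪ hyperbolicPoints σ ω ∪ ellipticPoints σ ρ) ∩ S).ncard =
      (curvePoints σ ∩ S).ncard + (hyperbolicPoints σ ω ∩ S).ncard +
        (ellipticPoints σ ρ ∩ S).ncard := by
  have : Finite (PGPoint F) := Quotient.finite _
  rw [Set.union_inter_distrib_right, Set.union_inter_distrib_right,
    Set.ncard_union_eq, Set.ncard_union_eq]
  · exact h01.mono Set.inter_subset_left Set.inter_subset_left
  · exact Disjoint.union_left (h02.mono Set.inter_subset_left Set.inter_subset_left)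
      (h12.mono Set.inter_subset_left Set.inter_subset_left)

theorem ncard_union (h : IsFrobInvolution q σ ξ) {ρ : F} (hρ : ρ * σ ρ ≠ 1) (hρ0 : ρ ≠ 0)
    (h01 : Disjoint (curvePoints σ) (hyperbolicPoints σ (ξ ^ ((q + 1) / 2))))
    (h02 : Disjoint (curvePoints σ) (ellipticPoints σ ρ))
    (h12 : Disjoint (hyperbolicPoints σ (ξ ^ ((q + 1) / 2))) (ellipticPoints σ ρ)) :
    (curvePoints σ ∪ hyperbolicPoints σ (ξ ^ ((q + 1) / 2)) ∪ ellipticPoints σ ρ).ncard =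
      (q ^ 2 + 1) * (q ^ 3 + 1) := by
  rw [← h.count_zero hρ (h.isotropicCard_eq 0) (h.card_hyperbolic_eq 0)
    (h.card_elliptic_eq hρ hρ0 0), ← ncard_union_inter _ _ h01 h02 h12]
  simp

theorem ncard_section (h : IsFrobInvolution q σ ξ) {ρ : F} (hρ : ρ * σ ρ ≠ 1) (hρ0 : ρ ≠ 0)
    (h01 : Disjoint (curvePoints σ) (hyperbolicPoints σ (ξ ^ ((q + 1) / 2))))
    (h02 : Disjoint (curvePoints σ) (ellipticPoints σ ρ))
    (h12 : Disjoint (hyperbolicPoints σ (ξ ^ ((q + 1) / 2))) (ellipticPoints σ ρ))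
    {π : Set (PGPoint F)} (hπ : IsPlane π) :
    (π ∩ (curvePoints σ ∪ hyperbolicPoints σ (ξ ^ ((q + 1) / 2)) ∪
      ellipticPoints σ ρ)).ncard = q ^ 3 + 1 ∨
    (π ∩ (curvePoints σ ∪ hyperbolicPoints σ (ξ ^ ((q + 1) / 2)) ∪
      ellipticPoints σ ρ)).ncard = q ^ 3 + q ^ 2 + 1 := by
  obtain ⟨W, hW, rfl⟩ := hπ
  obtain ⟨f, hf0, hf⟩ := Submodule.exists_le_ker_of_lt_top W (by
    rw [lt_top_iff_ne_top]
    rintro rfl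
    simp at hW)
  have hW' : W = LinearMap.ker f := by
    apply Submodule.eq_of_le_of_finrank_le hf
    have h1 := f.finrank_range_add_finrank_ker
    have h2 : 0 < Module.finrank F (LinearMap.range f) := by
      rw [Module.finrank_pos_iff, Submodule.nontrivial_iff_ne_bot, ne_eq, LinearMap.range_eq_bot]
      exact hf0
    rw [Module.finrank_fin_fun] at h1
    omega
  obtain ⟨l, rfl⟩ : ∃ l : Fin 4 → F, dotProductEquiv F (Fin 4) l = f :=
    (dotProductEquiv F (Fin 4)).surjective f
  have hl : l ≠ 0 := by
    rintro rfl
    simp at hf0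
  have hS : {P : PGPoint F | P.rep ∈ W} = {P | l ⬝ᵥ P.rep = 0} := by
    ext P
    rw [hW']
    simp
  rw [hS, Set.inter_comm, ncard_union_inter _ _ h01 h02 h12]
  exact h.count_of_ne_zero hρ hρ0 hl (h.isotropicCard_eq l) (h.card_hyperbolic_eq l)
    (h.card_elliptic_eq hρ hρ0 l)

theorem exists_eq_herProd (h : IsFrobInvolution q σ ξ) {v : Fin 4 → F} (hv : quad v = 0) :
    ∃ x y, v = herProd σ x y := by
  rw [quad, sub_eq_zero] at hv
  rcases eq_or_ne (v 0) 0 with h0 | h0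
  · rw [h0, zero_mul, eq_comm, mul_eq_zero] at hv
    rcases hv with h1 | h2
    · refine ⟨(0, 1), (v 2, v 3), ?_⟩
      ext i; fin_cases i <;> simp [herProd, h0, h1]
    · refine ⟨(σ (v 1), σ (v 3)), (0, 1), ?_⟩
      ext i; fin_cases i <;> simp [herProd, h0, h2, h.sigma_sigma]
  · refine ⟨(1, σ (v 2 / v 0)), (v 0, v 1), ?_⟩
    ext i
    fin_cases i <;> simp [herProd, h.sigma_sigma]
    · field_simp
    · field_simp
      linear_combination hv

theorem herm_herProd (h : IsFrobInvolution q σ ξ) (x y : F × F) :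
    herm σ (herProd σ x y) = -(det₂ x y * σ (det₂ x y)) := by
  simp [herm, herProd, det₂, h.sigma_sigma]
  ring

theorem herm_hyperbolic (h : IsFrobInvolution q σ ξ) (r : F) (x y : F × F) :
    herm σ (r • herProd σ x x + herProd σ y y) = (r + σ r) * (det₂ x y * σ (det₂ x y)) := by
  simp [herm, herProd, det₂, h.sigma_sigma]
  ring

theorem herm_elliptic (h : IsFrobInvolution q σ ξ) (r : F) (x y : F × F) :
    herm σ (r • herProd σ x y + herProd σ y x) =
      -((r * σ r + 1) * (det₂ x y * σ (det₂ x y))) := by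
  simp [herm, herProd, det₂, h.sigma_sigma]
  ring

theorem sigma_herm (h : IsFrobInvolution q σ ξ) (v : Fin 4 → F) :
    σ (herm σ v) = herm σ v := by
  simp [herm, h.sigma_sigma]
  ring

theorem mk_mem_curvePoints (h : IsFrobInvolution q σ ξ) {v : Fin 4 → F} (hv : v ≠ 0) :
    Projectivization.mk F v hv ∈ curvePoints σ ↔ quad v = 0 ∧ herm σ v = 0 := by
  rw [curvePoints, mk_mem_pointsOf]
  simp only [mem_filter, mem_univ, true_and]
  constructor
  · rintro ⟨x, -, t, -, rfl⟩
    rw [quad_smul, herm_smul, quad_herProd, h.herm_herProd]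
    simp [det₂, mul_comm]
  · rintro ⟨h1, h2⟩
    obtain ⟨x, y, rfl⟩ := h.exists_eq_herProd h1
    rw [h.herm_herProd, neg_eq_zero, mul_eq_zero, map_eq_zero, or_self] at h2
    have hx : x ≠ 0 := by
      rintro rfl
      exact hv (by ext i; fin_cases i <;> simp [herProd])
    obtain ⟨t, rfl⟩ := eq_smul_of_det₂_eq_zero hx h2
    rw [herProd_smul_right] at hv ⊢
    exact ⟨x, hx, t, left_ne_zero_of_smul hv, rfl⟩

theorem of_mk_mem_hyperbolicPoints (h : IsFrobInvolution q σ ξ) {v : Fin 4 → F} (hv : v ≠ 0)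
    (H : Projectivization.mk F v hv ∈ hyperbolicPoints σ (ξ ^ ((q + 1) / 2))) :
    quad v ≠ 0 ∧ herm σ v = 0 := by
  rw [hyperbolicPoints, mk_mem_pointsOf] at H
  simp only [mem_filter, mem_univ, true_and] at H
  obtain ⟨⟨x, y⟩, hxy, t, ht, rfl⟩ := H
  rw [quad_smul, herm_smul, quad_hyperbolic, h.herm_hyperbolic, h.sigma_omega]
  refine ⟨?_, by ring⟩
  exact mul_ne_zero (pow_ne_zero 2 ht) (mul_ne_zero h.omega_ne_zero
    (mul_ne_zero hxy ((map_ne_zero σ).2 hxy)))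

theorem half_pos (h : IsFrobInvolution q σ ξ) : 0 < (q + 1) / 2 := by
  have := h.one_lt
  omega

theorem sq_pow_half (h : IsFrobInvolution q σ ξ) (a : F) :
    (a ^ 2) ^ ((q + 1) / 2) = a * σ a := by
  rw [← pow_mul, h.half_mul, h.mul_sigma]

theorem pow_half_sq (h : IsFrobInvolution q σ ξ) (a : F) :
    (a ^ ((q + 1) / 2)) ^ 2 = a * σ a := by
  rw [← pow_mul, mul_comm, h.half_mul, h.mul_sigma]

theorem mul_sigma_eq_sq (h : IsFrobInvolution q σ ξ) {ρ w : F}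
    (hρ : (-ρ) ^ ((q + 1) / 2) = -w) : ρ * σ ρ = w ^ 2 := by
  have h1 := h.pow_half_sq (-ρ)
  rw [hρ, map_neg] at h1
  linear_combination -h1

/-- Parameters with the same image under the `(q + 1) / 2`-th power map give the same points. -/
theorem smul_mem_elliptic (h : IsFrobInvolution q σ ξ) {ρ ρ₁ : F} (hρ0 : ρ ≠ 0)
    (hρ : (-ρ) ^ ((q + 1) / 2) = (-ρ₁) ^ ((q + 1) / 2)) {x y : F × F} (hxy : det₂ x y = 1) :
    ∃ x' y' : F × F, det₂ x' y' = 1 ∧ ∃ t : F, t ≠ 0 ∧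
      ρ₁ • herProd σ x y + herProd σ y x = t • (ρ • herProd σ x' y' + herProd σ y' x') := by
  have hρ₁ : ρ₁ ≠ 0 := by
    rintro rfl
    rw [neg_zero, zero_pow h.half_pos.ne'] at hρ
    exact hρ0 (neg_eq_zero.1 (eq_zero_of_pow_eq_zero hρ))
  obtain ⟨m, hm⟩ := h.exists_pow (div_ne_zero hρ₁ hρ0)
  have h1 : ξ ^ (m * ((q + 1) / 2)) = 1 := by
    rw [pow_mul, hm, ← neg_div_neg_eq, div_pow, ← hρ]
    exact div_self (pow_ne_zero _ (neg_ne_zero.2 hρ0))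
  rw [h.prim.pow_eq_one_iff_dvd, h.sq_sub_one, mul_comm m, ← h.half_mul,
    mul_comm 2, mul_assoc, Nat.mul_div_cancel _ two_pos] at h1
  obtain ⟨j, rfl⟩ := Nat.dvd_of_mul_dvd_mul_left h.half_pos h1
  set α := ξ ^ j with hα
  have hα0 : α ≠ 0 := pow_ne_zero _ h.xi_ne_zero
  have hσ0 : σ α ≠ 0 := (map_ne_zero σ).2 hα0
  have h2 : σ α ^ 2 * ρ = ρ₁ * α ^ 2 := by
    have h3 : ξ ^ (2 * (q - 1) * j) * α ^ 2 = σ α ^ 2 := by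
      rw [h.frob, hα, ← pow_mul, ← pow_mul, ← pow_mul, ← pow_add]
      congr 1
      obtain ⟨r, rfl⟩ : ∃ r, q = r + 1 := ⟨q - 1, by have := h.one_lt; omega⟩
      simp only [Nat.add_sub_cancel]
      ring
    rw [← h3, hm]
    field_simp
  refine ⟨α • x, α⁻¹ • y, ?_, σ α / α, div_ne_zero hσ0 hα0, ?_⟩
  · rw [det₂_smul_smul, mul_inv_cancel₀ hα0, one_mul, hxy]
  · simp only [herProd_smul_left, herProd_smul_right, map_inv₀, smul_add, smul_smul]
    congr 2
    · field_simp
      linear_combination -h2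
    · field_simp
      rw [one_smul]

theorem mk_mem_ellipticPoints (h : IsFrobInvolution q σ ξ) {ρ w : F}
    (hρ : (-ρ) ^ ((q + 1) / 2) = -w) (hw0 : w ≠ 0) (hw4 : w ^ 4 ≠ 1)
    (hw : σ w = w ∨ σ w = -w) {v : Fin 4 → F} (hv : v ≠ 0) :
    Projectivization.mk F v hv ∈ ellipticPoints σ ρ ↔
      quad v ≠ 0 ∧ herm σ v = (w + w⁻¹) * quad v ^ ((q + 1) / 2) := by
  have hρ0 : ρ ≠ 0 := by
    rintro rfl
    rw [neg_zero, zero_pow h.half_pos.ne', eq_comm, neg_eq_zero] at hρ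
    exact hw0 hρ
  have hN := h.mul_sigma_eq_sq hρ
  rw [ellipticPoints, mk_mem_pointsOf]
  simp only [mem_filter, mem_univ, true_and]
  constructor
  · rintro ⟨⟨x, y⟩, hxy, t, ht, rfl⟩
    rw [quad_smul, herm_smul, quad_elliptic, h.herm_elliptic, hxy, hN, mul_pow, map_one, mul_one,
      mul_one, mul_one, hρ, h.sq_pow_half]
    refine ⟨mul_ne_zero (pow_ne_zero 2 ht) (neg_ne_zero.2 hρ0), ?_⟩
    field_simp
  · rintro ⟨hQ, hH⟩
    have hw2 : 1 - w ^ 2 ≠ 0 := fun H => hw4 (by linear_combination -(1 + w ^ 2) * H)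
    have hw2' : w ^ 2 + 1 ≠ 0 := fun H => hw4 (by linear_combination (w ^ 2 - 1) * H)
    have hγ : w + w⁻¹ ≠ 0 := by
      intro H
      apply hw2'
      have h1 := mul_inv_cancel₀ hw0
      linear_combination w * H - h1
    have hR2 := h.pow_half_sq (quad v)
    set Q := quad v with hQdef
    set R := Q ^ ((q + 1) / 2) with hRdef
    have hR0 : R ≠ 0 := pow_ne_zero _ hQ
    have hσr : σ (R * w) = R * w := by
      have h1 := h.sigma_herm v
      rw [hH, map_mul, map_add, map_inv₀] at h1
      rw [map_mul]
      apply mul_left_cancel₀ hγ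
      rcases hw with hw | hw
      · rw [hw] at h1 ⊢
        linear_combination w * h1
      · rw [hw, inv_neg] at h1
        rw [hw]
        linear_combination w * h1
    set r := R * w with hr
    have hu : quad (conjComb σ r Q v) = 0 := by
      rw [quad_conjComb, hH, ← hQdef, sq Q, mul_assoc Q, ← hR2, hr]
      field_simp
      ring
    obtain ⟨x, y, hxy⟩ := h.exists_eq_herProd hu
    have hv' : (R ^ 2 * (1 - w ^ 2)) • v = r • herProd σ x y + Q • herProd σ y x := by
      have h2 : herProd σ y x = ![σ (herProd σ x y 0), σ (herProd σ x y 2),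
          σ (herProd σ x y 1), σ (herProd σ x y 3)] := by
        ext i
        fin_cases i <;> simp [herProd, h.sigma_sigma, mul_comm]
      rw [h2, ← hxy]
      ext i
      fin_cases i <;> simp [conjComb, h.sigma_sigma, hσr] <;> linear_combination (v _) * hR2
    have hc : R ^ 2 * (1 - w ^ 2) ≠ 0 := mul_ne_zero (pow_ne_zero 2 hR0) hw2
    have hv'' : (R ^ 2 * (1 - w ^ 2)) • v =
        Q • ((r / Q) • herProd σ x y + herProd σ y x) := by
      rw [hv', smul_add, smul_smul, mul_div_cancel₀ _ hQ]
    have hD : det₂ x y ≠ 0 := by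
      intro H
      have h3 := congrArg quad hv''
      rw [quad_smul, quad_smul, quad_elliptic, H, zero_mul, mul_zero, mul_zero] at h3
      exact mul_ne_zero (pow_ne_zero 2 hc) hQ h3
    set D := det₂ x y with hDdef
    have hσD : σ D ≠ 0 := (map_ne_zero σ).2 hD
    have hx : x = D • D⁻¹ • x := by rw [smul_smul, mul_inv_cancel₀ hD, one_smul]
    have hdet : det₂ (D⁻¹ • x) y = 1 := by
      have h3 := det₂_smul_smul x y D⁻¹ 1
      rwa [one_smul, mul_one, ← hDdef, inv_mul_cancel₀ hD] at h3
    generalize D⁻¹ • x = x' at hx hdet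
    set ρ₁ := r / Q * σ D / D with hρ₁
    have hρ₁N : ρ₁ * σ ρ₁ = w ^ 2 := by
      have hσQ : σ Q ≠ 0 := (map_ne_zero σ).2 hQ
      rw [hρ₁]
      simp only [map_mul, map_div₀, hσr, h.sigma_sigma]
      field_simp
      rw [hr]
      linear_combination w ^ 2 * hR2
    obtain ⟨s, hs0, hs⟩ : ∃ s : F, s ≠ 0 ∧ v = s • (ρ₁ • herProd σ x' y + herProd σ y x') := by
      refine ⟨(R ^ 2 * (1 - w ^ 2))⁻¹ * Q * D,
        mul_ne_zero (mul_ne_zero (inv_ne_zero hc) hQ) hD, ?_⟩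
      rw [mul_assoc, ← smul_smul, eq_inv_smul_iff₀ hc, hv'', ← smul_smul]
      congr 1
      rw [hx, herProd_smul_left, herProd_smul_right, smul_add, smul_smul, smul_smul, hρ₁]
      congr 2
      field_simp
    have hT : (-ρ₁) ^ ((q + 1) / 2) = -w := by
      rw [hRdef, hQdef, hs, quad_smul, herm_smul, quad_elliptic, h.herm_elliptic, hdet, hρ₁N,
        mul_pow, map_one, mul_one, mul_one, mul_one, h.sq_pow_half] at hH
      have h4 := mul_inv_cancel₀ hw0
      have hsσ : s * σ s ≠ 0 := mul_ne_zero hs0 ((map_ne_zero σ).2 hs0)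
      apply mul_left_cancel₀ (mul_ne_zero hsσ hw2')
      linear_combination (-w) * hH + s * σ s * (-ρ₁) ^ ((q + 1) / 2) * h4 * (-1)
    obtain ⟨x'', y'', h5, t, ht, h6⟩ := h.smul_mem_elliptic hρ0 (hρ.trans hT.symm) hdet
    exact ⟨(x'', y''), h5, s * t, mul_ne_zero hs0 ht, by rw [hs, h6, smul_smul]⟩

theorem isSquare_neg_one (h : IsFrobInvolution q σ ξ) : IsSquare (-1 : F) := by
  rw [FiniteField.isSquare_neg_one_iff, h.card]
  obtain ⟨r, rfl⟩ := h.odd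
  have : (2 * r + 1) ^ 2 = 4 * (r ^ 2 + r) + 1 := by ring
  omega

theorem exists_det₂_eq_one_of_hyperbolic (h : IsFrobInvolution q σ ξ) {x y : F × F}
    (hxy : det₂ x y ≠ 0) :
    ∃ x' y' : F × F, det₂ x' y' = 1 ∧ ∃ t : F,
      ξ ^ ((q + 1) / 2) • herProd σ x' x' + herProd σ y' y' =
        t • (ξ ^ ((q + 1) / 2) • herProd σ x x + herProd σ y y) := by
  have hω := h.pow_half_sq ξ
  have hξ := h.xi_ne_zero
  set ω := ξ ^ ((q + 1) / 2)
  obtain ⟨m, hm⟩ := h.exists_pow hxy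
  rcases Nat.even_or_odd' m with ⟨j, rfl | rfl⟩
  · refine ⟨(ξ ^ j)⁻¹ • x, (ξ ^ j)⁻¹ • y, ?_, (ξ ^ j)⁻¹ * σ (ξ ^ j)⁻¹, ?_⟩
    · rw [det₂_smul_smul, ← hm]
      field_simp
      ring
    · simp only [herProd_smul_left, herProd_smul_right]
      module
  · obtain ⟨i, hi⟩ := h.isSquare_neg_one
    set b := i / ξ ^ (j + 1) with hb
    refine ⟨b • y, (ξ * b) • x, ?_, b * σ b * ω, ?_⟩
    · rw [det₂_smul_smul, det₂_comm, ← hm, hb]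
      field_simp
      linear_combination ξ ^ 2 * ξ ^ (j * 2) * hi
    · simp only [herProd_smul_left, herProd_smul_right, map_mul]
      have h1 : (ξ * b) • (σ ξ * σ b) • herProd σ x x = (b * σ b * ω ^ 2) • herProd σ x x := by
        rw [hω]
        module
      rw [h1]
      module

theorem vecMul_kron (h : IsFrobInvolution q σ ξ) (A : Matrix (Fin 2) (Fin 2) F) (v : Fin 4 → F) :
    Matrix.vecMul v (kron (matq q A) A) =
      v 0 • herProd σ (A 0 0, A 0 1) (A 0 0, A 0 1) +
      v 1 • herProd σ (A 0 0, A 0 1) (A 1 0, A 1 1) +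
      v 2 • herProd σ (A 1 0, A 1 1) (A 0 0, A 0 1) +
      v 3 • herProd σ (A 1 0, A 1 1) (A 1 0, A 1 1) := by
  ext i
  fin_cases i <;>
    simp [Matrix.vecMul, dotProduct, Fin.sum_univ_four, kron, matq, herProd, h.frob]

theorem korb_eq (h : IsFrobInvolution q σ ξ) {v₀ : Fin 4 → F} (hv₀ : v₀ ≠ 0)
    (hv₀' : v₀ = ![ξ ^ ((q + 1) / 2), 0, 0, 1]) :
    Korb q (Projectivization.mk F v₀ hv₀) = hyperbolicPoints σ (ξ ^ ((q + 1) / 2)) := by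
  ext P
  constructor
  · rintro ⟨A, hA, v, hv, hw, hP, rfl⟩
    obtain ⟨t, ht⟩ := (Projectivization.mk_eq_mk_iff' F _ _ _ _).1 hP.symm
    have ht0 : t ≠ 0 := by
      rintro rfl
      exact hv (by rw [← ht, zero_smul])
    rw [hyperbolicPoints, mk_mem_pointsOf]
    rw [Matrix.det_fin_two] at hA
    refine ⟨((A 0 0, A 0 1), (A 1 0, A 1 1)), ?_, t, ht0, ?_⟩
    · rw [mem_filter_univ, det₂, hA]
      exact one_ne_zero
    · rw [h.vecMul_kron, ← ht, hv₀']
      simp [smul_smul]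
  · rintro ⟨⟨x, y⟩, hxy, hP, rfl⟩
    rw [mem_filter_univ] at hxy
    obtain ⟨x', y', hdet, t, ht⟩ := h.exists_det₂_eq_one_of_hyperbolic hxy
    have hw : Matrix.vecMul v₀ (kron (matq q !![x'.1, x'.2; y'.1, y'.2])
        !![x'.1, x'.2; y'.1, y'.2]) =
        ξ ^ ((q + 1) / 2) • herProd σ x' x' + herProd σ y' y' := by
      rw [h.vecMul_kron, hv₀']
      simp
    have hw0 := hyperbolic_ne_zero (σ := σ) (ξ ^ ((q + 1) / 2)) (x := x') (y := y')
      (by rw [hdet]; exact one_ne_zero)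
    refine ⟨!![x'.1, x'.2; y'.1, y'.2], ?_, v₀, hv₀, by rwa [hw], rfl, ?_⟩
    · rw [Matrix.det_fin_two]
      simp only [det₂] at hdet
      simp
      linear_combination hdet
    · symm
      rw [Projectivization.mk_eq_mk_iff']
      exact ⟨t, by rw [hw, ht]⟩

theorem fgam_eq (h : IsFrobInvolution q σ ξ) (γ : F) (v : Fin 4 → F) :
    Fgam q γ v = herm σ v - γ * quad v ^ ((q + 1) / 2) := by
  rw [Fgam, herm, quad]
  simp only [h.frob, pow_succ]
  ring

theorem herm_sub_smul (h : IsFrobInvolution q σ ξ) (γ t : F) (v : Fin 4 → F) :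
    herm σ (t • v) - γ * quad (t • v) ^ ((q + 1) / 2) =
      t * σ t * (herm σ v - γ * quad v ^ ((q + 1) / 2)) := by
  rw [quad_smul, herm_smul, mul_pow, h.sq_pow_half]
  ring

theorem mk_mem_cgam (h : IsFrobInvolution q σ ξ) (γ : F) {v : Fin 4 → F} (hv : v ≠ 0) :
    Projectivization.mk F v hv ∈ Cgam q γ ↔ herm σ v = γ * quad v ^ ((q + 1) / 2) := by
  rw [← sub_eq_zero]
  constructor
  · intro H
    rw [← h.fgam_eq]
    exact H v hv rfl
  · intro H u hu hP
    obtain ⟨t, rfl⟩ := (Projectivization.mk_eq_mk_iff' F _ _ _ _).1 hP.symm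
    rw [h.fgam_eq, h.herm_sub_smul, H, mul_zero]

theorem cgam_eq (h : IsFrobInvolution q σ ξ) {ρ w : F}
    (hρ : (-ρ) ^ ((q + 1) / 2) = -w) (hw0 : w ≠ 0) (hw4 : w ^ 4 ≠ 1)
    (hw : σ w = w ∨ σ w = -w) :
    Cgam q (w + w⁻¹) = curvePoints σ ∪ ellipticPoints σ ρ := by
  ext P
  induction P using Projectivization.ind with
  | h v hv =>
    rw [Set.mem_union, h.mk_mem_cgam, h.mk_mem_curvePoints,
      h.mk_mem_ellipticPoints hρ hw0 hw4 hw]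
    rcases eq_or_ne (quad v) 0 with H | H
    · simp [H, h.half_pos.ne']
    · simp [H]

theorem disjoint_curve_hyperbolic (h : IsFrobInvolution q σ ξ) :
    Disjoint (curvePoints σ) (hyperbolicPoints σ (ξ ^ ((q + 1) / 2))) := by
  rw [Set.disjoint_left]
  intro P h1 h2
  induction P using Projectivization.ind with
  | h v hv =>
    rw [h.mk_mem_curvePoints] at h1
    exact (h.of_mk_mem_hyperbolicPoints hv h2).1 h1.1

theorem disjoint_curve_elliptic (h : IsFrobInvolution q σ ξ) {ρ w : F}
    (hρ : (-ρ) ^ ((q + 1) / 2) = -w) (hw0 : w ≠ 0) (hw4 : w ^ 4 ≠ 1)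
    (hw : σ w = w ∨ σ w = -w) : Disjoint (curvePoints σ) (ellipticPoints σ ρ) := by
  rw [Set.disjoint_left]
  intro P h1 h2
  induction P using Projectivization.ind with
  | h v hv =>
    rw [h.mk_mem_curvePoints] at h1
    rw [h.mk_mem_ellipticPoints hρ hw0 hw4 hw] at h2
    exact h2.1 h1.1

theorem disjoint_hyperbolic_elliptic (h : IsFrobInvolution q σ ξ) {ρ w : F}
    (hρ : (-ρ) ^ ((q + 1) / 2) = -w) (hw0 : w ≠ 0) (hw4 : w ^ 4 ≠ 1)
    (hw : σ w = w ∨ σ w = -w) :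
    Disjoint (hyperbolicPoints σ (ξ ^ ((q + 1) / 2))) (ellipticPoints σ ρ) := by
  rw [Set.disjoint_left]
  intro P h1 h2
  induction P using Projectivization.ind with
  | h v hv =>
    obtain ⟨h3, h4⟩ := h.of_mk_mem_hyperbolicPoints hv h1
    rw [h.mk_mem_ellipticPoints hρ hw0 hw4 hw, h4, eq_comm, mul_eq_zero] at h2
    rcases h2.2 with H | H
    · apply hw4
      have h5 := mul_inv_cancel₀ hw0
      linear_combination (w ^ 2 - 1) * w * H - (w ^ 2 - 1) * h5
    · exact pow_ne_zero _ h3 H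

theorem isQuasiHermitian (h : IsFrobInvolution q σ ξ) {ρ w : F}
    (hρ : (-ρ) ^ ((q + 1) / 2) = -w) (hw0 : w ≠ 0) (hw4 : w ^ 4 ≠ 1)
    (hw : σ w = w ∨ σ w = -w) {v₀ : Fin 4 → F} (hv₀ : v₀ ≠ 0)
    (hv₀' : v₀ = ![ξ ^ ((q + 1) / 2), 0, 0, 1]) :
    (Korb q (Projectivization.mk F v₀ hv₀) ∪ Cgam q (w + w⁻¹)).ncard =
        (q ^ 2 + 1) * (q ^ 3 + 1) ∧
      ∀ π : Set (PGPoint F), IsPlane π →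
        (π ∩ (Korb q (Projectivization.mk F v₀ hv₀) ∪ Cgam q (w + w⁻¹))).ncard = q ^ 3 + 1 ∨
        (π ∩ (Korb q (Projectivization.mk F v₀ hv₀) ∪ Cgam q (w + w⁻¹))).ncard =
          q ^ 3 + q ^ 2 + 1 := by
  have hρ0 : ρ ≠ 0 := by
    rintro rfl
    rw [neg_zero, zero_pow h.half_pos.ne', eq_comm, neg_eq_zero] at hρ
    exact hw0 hρ
  have hN : ρ * σ ρ ≠ 1 := by
    rw [h.mul_sigma_eq_sq hρ]
    exact fun H => hw4 (by linear_combination (w ^ 2 + 1) * H)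
  have h01 := h.disjoint_curve_hyperbolic
  have h02 := h.disjoint_curve_elliptic hρ hw0 hw4 hw
  have h12 := h.disjoint_hyperbolic_elliptic hρ hw0 hw4 hw
  rw [h.korb_eq hv₀ hv₀', h.cgam_eq hρ hw0 hw4 hw, Set.union_left_comm, ← Set.union_assoc]
  exact ⟨h.ncard_union hN hρ0 h01 h02 h12, fun π hπ => h.ncard_section hN hρ0 h01 h02 h12 hπ⟩

end IsFrobInvolution

theorem exists_isFrobInvolution {p n q : ℕ} (hp : p.Prime) (hodd : Odd p) (hn : 0 < n)
    (hq : q = p ^ n) (hF : Fintype.card F = q ^ 2) {ξ : F}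
    (hξ : ∀ x : F, x ≠ 0 → ∃ m : ℕ, x = ξ ^ m) : ∃ σ : F →+* F, IsFrobInvolution q σ ξ := by
  have : Fact p.Prime := ⟨hp⟩
  have hchar : CharP F p := charP_of_card_eq_prime_pow (f := n * 2) (by
    rw [hF, hq, pow_mul])
  have hq1 : 1 < q := hq ▸ Nat.one_lt_pow hn.ne' hp.one_lt
  refine ⟨iterateFrobenius F p n, hq ▸ hodd.pow, hq1, hF, fun x => by
    rw [iterateFrobenius_def, hq], ?_⟩
  have hξ0 : ξ ≠ 0 := by
    rintro rfl
    obtain ⟨m, hm⟩ := hξ (-1) (neg_ne_zero.2 one_ne_zero)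
    have h2 : ringChar F ≠ 2 := by
      rw [ringChar.eq F p]
      rintro rfl
      exact absurd hodd (by decide)
    rcases Nat.eq_zero_or_pos m with rfl | hm0
    · rw [pow_zero] at hm
      exact Ring.neg_one_ne_one_of_char_ne_two h2 hm
    · rw [zero_pow hm0.ne'] at hm
      exact neg_ne_zero.2 one_ne_zero hm
  rw [IsPrimitiveRoot.iff_orderOf, ← hF, ← Fintype.card_units]
  have h1 : orderOf (Units.mk0 ξ hξ0) = Fintype.card Fˣ := by
    rw [← Nat.card_eq_fintype_card]
    apply orderOf_eq_card_of_forall_mem_zpowers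
    intro u
    obtain ⟨m, hm⟩ := hξ u u.ne_zero
    exact ⟨m, by ext; simp [hm]⟩
  rw [← h1, ← orderOf_units, Units.val_mk0]

namespace IsFrobInvolution

theorem exists_parameters (h : IsFrobInvolution q σ ξ) {k : ℕ} (hk1 : 1 ≤ k) (hkq : k ≤ q - 2)
    (hkne : k ≠ (q - 1) / 2) :
    let w := ξ ^ (k * (q + 1) / 2)
    (-(-ξ ^ (q - 1 + k))) ^ ((q + 1) / 2) = -w ∧ w ≠ 0 ∧ w ^ 4 ≠ 1 ∧
      (σ w = w ∨ σ w = -w) := by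
  intro w
  have hw : w = (ξ ^ ((q + 1) / 2)) ^ k := by
    have h2 : k * (q + 1) / 2 = (q + 1) / 2 * k := by
      rw [← h.half_mul, Nat.mul_left_comm, Nat.mul_div_cancel_left _ two_pos,
        Nat.mul_div_cancel_left _ two_pos, mul_comm]
    rw [← pow_mul, ← h2]
  have hs := h.sigma_omega
  have hs1 : (ξ ^ ((q + 1) / 2)) ^ (q - 1) = -1 := by
    apply mul_right_cancel₀ h.omega_ne_zero
    rw [← pow_succ, Nat.sub_add_cancel h.one_lt.le, ← h.frob, hs, neg_one_mul]
  refine ⟨?_, pow_ne_zero _ h.xi_ne_zero, ?_, ?_⟩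
  · rw [neg_neg, ← pow_mul, mul_comm, pow_mul, pow_add, hs1, hw, neg_one_mul]
  · rw [hw, ← pow_mul, ← pow_mul, ne_eq, h.prim.pow_eq_one_iff_dvd, h.sq_sub_one,
      ← h.half_mul, mul_comm 2, mul_assoc, Nat.mul_div_cancel _ two_pos]
    intro H
    have h1 := Nat.dvd_of_mul_dvd_mul_left h.half_pos H
    obtain ⟨c, hc⟩ : q - 1 ∣ 2 * k := by
      apply Nat.dvd_of_mul_dvd_mul_left two_pos
      rwa [← mul_assoc 2 2 k, mul_comm _ k]
    have h3 := h.one_lt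
    rcases c with _ | _ | c
    · omega
    · omega
    · have : 2 * (q - 1) ≤ (q - 1) * (c + 1 + 1) := by nlinarith
      omega
  · rw [hw, map_pow, hs]
    rcases Nat.even_or_odd k with hk | hk
    · exact Or.inl (hk.neg_pow _)
    · exact Or.inr (hk.neg_pow _)

end IsFrobInvolution

end QuasiHermitian

/-- Theorem 2.29 (third family): `H₁ ∪ E_k` is a quasi-Hermitian surface of
    `PG(3,q²)`, where `H₁` is the `K`-orbit of the point `(ξ^{(q+1)/2}, 0, 0, 1)`. -/
theorem stmt18 {F : Type*} [Field F] [Fintype F] (p n q : ℕ) (hp : p.Prime)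
    (hodd : Odd p) (hn : 0 < n) (hq : q = p ^ n) (hF : Fintype.card F = q ^ 2)
    (ξ : F) (hξ : ∀ x : F, x ≠ 0 → ∃ m : ℕ, x = ξ ^ m)
    (k : ℕ) (hk1 : 1 ≤ k) (hkq : k ≤ q - 2) (hkne : k ≠ (q - 1) / 2) :
    let H1 : Set (PGPoint F) := Korb q (Projectivization.mk F
      ![ξ ^ ((q + 1) / 2), 0, 0, 1] (by intro h; have := congrFun h 3; simp at this))
    let V : Set (PGPoint F) :=
      H1 ∪ Cgam q (ξ ^ (k * (q + 1) / 2) + (ξ ^ (k * (q + 1) / 2))⁻¹)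
    V.ncard = (q ^ 2 + 1) * (q ^ 3 + 1) ∧
      ∀ π : Set (PGPoint F), IsPlane π →
        (π ∩ V).ncard = q ^ 3 + 1 ∨ (π ∩ V).ncard = q ^ 3 + q ^ 2 + 1 := by
  intro H1 V
  obtain ⟨σ, h⟩ := exists_isFrobInvolution hp hodd hn hq hF hξ
  obtain ⟨hρ, hw0, hw4, hw⟩ := h.exists_parameters hk1 hkq hkne
  exact h.isQuasiHermitian hρ hw0 hw4 hw _ rfl
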